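/- arXiv:2010.12629 — 4 statements merged into one kernel-verified Lean document; each statement's English description precedes it below -/
import Mathlib

section
/- For every n ≥ 1 and every total Boolean function f : {0,1}^n → {0,1}, deg(f) ≤ λ(f)². -/
noncomputable def specNorm {I : Type*} [Fintype I] [DecidableEq I] (A : Matrix I I ℝ) : ℝ :=
  ‖Matrix.toEuclideanCLM (𝕜 := ℝ) A‖

/-- Adjacency matrix of the sensitivity graph of `f`. -/
def sensAdj {I : Type*} [Fintype I] [DecidableEq I] (f : (I → Bool) → Bool) :
    Matrix (I → Bool) (I → Bool) ℝ :=
  Matrix.of fun x y => if hammingDist x y = 1 ∧ f x ≠ f y then (1 : ℝ) else 0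

/-- Spectral sensitivity `λ(f)`: the ℓ2→ℓ2 operator norm of the adjacency matrix of the
sensitivity graph of `f`. -/
noncomputable def specSens {I : Type*} [Fintype I] [DecidableEq I] (f : (I → Bool) → Bool) : ℝ :=
  specNorm (sensAdj f)

/-- Degree of a Boolean function: minimum total degree of a real polynomial representing it
exactly on the Boolean cube. -/
noncomputable def degB {n : ℕ} (f : (Fin n → Bool) → Bool) : ℕ :=
  sInf {d | ∃ p : MvPolynomial (Fin n) ℝ, p.totalDegree = d ∧
    ∀ x : Fin n → Bool,
      MvPolynomial.eval (fun i => if x i then (1 : ℝ) else 0) p = (if f x then 1 else 0)}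

/-- Flip the `i`-th bit of `x`. -/
def flipBit {I : Type*} [DecidableEq I] (i : I) (x : I → Bool) : I → Bool :=
  Function.update x i (!x i)

/-- The sign `-1` or `1` of a bit. -/
def bitSign (b : Bool) : ℝ := if b then -1 else 1

lemma bitSign_not (b : Bool) : bitSign (!b) = -bitSign b := by
  cases b <;> simp [bitSign]

lemma bitSign_mul_self (b : Bool) : bitSign b * bitSign b = 1 := by
  cases b <;> simp [bitSign]

lemma flipBit_flipBit {I : Type*} [DecidableEq I] (i : I) (x : I → Bool) :
    flipBit i (flipBit i x) = x := by
  simp [flipBit]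

lemma flipBit_comm {I : Type*} [DecidableEq I] (i j : I) (x : I → Bool) :
    flipBit i (flipBit j x) = flipBit j (flipBit i x) := by
  ext k
  simp only [flipBit, Function.update_apply]
  by_cases h : i = j
  · subst h; rfl
  · by_cases hi : k = i
    · subst hi; simp [h]
    · by_cases hj : k = j
      · subst hj; simp [hi]
      · simp [hi, hj]

lemma flipBit_left_injective {I : Type*} [DecidableEq I] (x : I → Bool) :
    Function.Injective fun i => flipBit i x := by
  intro i j h
  by_contra hij
  have := congrFun h i
  simp [flipBit, Function.update_of_ne hij] at this

lemma hammingDist_flipBit {I : Type*} [Fintype I] [DecidableEq I] (i : I) (x : I → Bool) :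
    hammingDist x (flipBit i x) = 1 := by
  rw [hammingDist, Finset.card_eq_one]
  refine ⟨i, ?_⟩
  ext j
  rw [Finset.mem_filter, Finset.mem_singleton]
  by_cases h : j = i
  · subst h; simp [flipBit]
  · simp [flipBit, h]

/-- The parity character of the cube. -/
def parityChar {I : Type*} [Fintype I] (x : I → Bool) : ℝ := ∏ i, bitSign (x i)

lemma prod_bitSign_flipBit_of_mem {I : Type*} [DecidableEq I] {s : Finset I} {i : I}
    (hi : i ∈ s) (x : I → Bool) :
    ∏ j ∈ s, bitSign (flipBit i x j) = -∏ j ∈ s, bitSign (x j) := by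
  rw [← Finset.mul_prod_erase s _ hi, ← Finset.mul_prod_erase s (fun j => bitSign (x j)) hi,
    ← neg_mul]
  congr 1
  · simp [flipBit, bitSign_not]
  · refine Finset.prod_congr rfl fun j hj => ?_
    simp [flipBit, Finset.ne_of_mem_erase hj]

lemma prod_bitSign_flipBit_of_notMem {I : Type*} [DecidableEq I] {s : Finset I} {i : I}
    (hi : i ∉ s) (x : I → Bool) :
    ∏ j ∈ s, bitSign (flipBit i x j) = ∏ j ∈ s, bitSign (x j) := by
  refine Finset.prod_congr rfl fun j hj => ?_
  have : j ≠ i := fun h => hi (h ▸ hj)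
  simp [flipBit, this]

lemma prod_bitSign_mul_self {I : Type*} (s : Finset I) (x : I → Bool) :
    (∏ j ∈ s, bitSign (x j)) * ∏ j ∈ s, bitSign (x j) = 1 := by
  rw [← Finset.prod_mul_distrib]
  exact Finset.prod_eq_one fun j _ => bitSign_mul_self _

lemma parityChar_flipBit {I : Type*} [Fintype I] [DecidableEq I] (i : I) (x : I → Bool) :
    parityChar (flipBit i x) = -parityChar x :=
  prod_bitSign_flipBit_of_mem (Finset.mem_univ i) x

lemma sum_parityChar {I : Type*} [Fintype I] [DecidableEq I] [Nonempty I] :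
    ∑ x : I → Bool, parityChar x = 0 := by
  obtain ⟨i⟩ := ‹Nonempty I›
  have h : ∑ x : I → Bool, parityChar (flipBit i x) = ∑ x : I → Bool, parityChar x :=
    Equiv.sum_comp (Function.Involutive.toPerm (flipBit i) (flipBit_flipBit i)) parityChar
  simp only [parityChar_flipBit, Finset.sum_neg_distrib] at h
  linarith

/-- The sign carried by the edge in direction `i` at `x` in Huang's signing of the hypercube. -/
def edgeSign {I : Type*} [Fintype I] [LinearOrder I] (i : I) (x : I → Bool) : ℝ :=
  ∏ j ∈ Finset.univ.filter (· < i), bitSign (x j)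

lemma abs_edgeSign {I : Type*} [Fintype I] [LinearOrder I] (i : I) (x : I → Bool) :
    |edgeSign i x| = 1 := by
  have h : edgeSign i x * edgeSign i x = 1 := prod_bitSign_mul_self _ x
  rcases mul_self_eq_one_iff.mp h with h | h <;> simp [h]

/-- Huang's signed adjacency operator of the hypercube. -/
def signedAdj (I : Type*) [Fintype I] [LinearOrder I] :
    ((I → Bool) → ℝ) →ₗ[ℝ] ((I → Bool) → ℝ) where
  toFun v x := ∑ i, edgeSign i x * v (flipBit i x)
  map_add' u v := by
    ext x
    simp [mul_add, Finset.sum_add_distrib]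
  map_smul' c v := by
    ext x
    simp only [Pi.smul_apply, smul_eq_mul, RingHom.id_apply, Finset.mul_sum]
    exact Finset.sum_congr rfl fun i _ => by ring

lemma signedAdj_apply {I : Type*} [Fintype I] [LinearOrder I] (v : (I → Bool) → ℝ)
    (x : I → Bool) : signedAdj I v x = ∑ i, edgeSign i x * v (flipBit i x) := rfl

lemma edgeSign_anticomm {I : Type*} [Fintype I] [LinearOrder I] {i k : I} (h : i ≠ k)
    (x : I → Bool) :
    edgeSign i x * edgeSign k (flipBit i x) = -(edgeSign k x * edgeSign i (flipBit k x)) := by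
  unfold edgeSign
  rcases lt_or_gt_of_ne h with h | h
  · rw [prod_bitSign_flipBit_of_mem (by simpa using h),
      prod_bitSign_flipBit_of_notMem (by simpa using h.le)]
    ring
  · rw [prod_bitSign_flipBit_of_mem (i := k) (by simpa using h),
      prod_bitSign_flipBit_of_notMem (by simpa using h.le)]
    ring

lemma signedAdj_signedAdj {I : Type*} [Fintype I] [LinearOrder I] (v : (I → Bool) → ℝ) :
    signedAdj I (signedAdj I v) = (Fintype.card I : ℝ) • v := by
  ext x
  set F : I → I → ℝ := fun i k =>
    edgeSign i x * (edgeSign k (flipBit i x) * v (flipBit k (flipBit i x))) with hF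
  have hdiag : ∀ i, F i i = v x := fun i => by
    have h1 : edgeSign i (flipBit i x) = edgeSign i x :=
      prod_bitSign_flipBit_of_notMem (by simp) x
    have h2 : edgeSign i x * edgeSign i x = 1 := prod_bitSign_mul_self _ x
    simp only [hF, flipBit_flipBit, h1, ← mul_assoc, h2, one_mul]
  have hoff : ∀ i k, i ≠ k → F i k = -F k i := fun i k hik => by
    simp only [hF, ← mul_assoc, edgeSign_anticomm hik, flipBit_comm k i, neg_mul]
  have hsym : ∀ i k, F i k + F k i = if i = k then 2 * v x else 0 := fun i k => by
    split_ifs with h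
    · subst h; rw [hdiag]; ring
    · rw [hoff i k h]; ring
  have hsum : ∑ i, ∑ k, F i k + ∑ i, ∑ k, F i k = Fintype.card I * (2 * v x) := by
    nth_rewrite 2 [Finset.sum_comm]
    simp only [← Finset.sum_add_distrib, hsym]
    simp
  simp only [signedAdj_apply, Finset.mul_sum, Pi.smul_apply, smul_eq_mul]
  change ∑ i, ∑ k, F i k = _
  linarith

/-- An operator with `B² = r²` has, on any set containing more than half of the
coordinates, a nonzero supported vector which is an eigenvector for `r` or `-r`. -/
lemma exists_supported_eigenvector {J : Type*} [Fintype J] (B : (J → ℝ) →ₗ[ℝ] (J → ℝ))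
    {r : ℝ} (hr : r ≠ 0) (hB : ∀ v, B (B v) = (r ^ 2) • v) (X : Finset J)
    (hX : Fintype.card J < 2 * X.card) :
    ∃ v : J → ℝ, v ≠ 0 ∧ (∀ x ∉ X, v x = 0) ∧ (B v = r • v ∨ B v = -r • v) := by
  classical
  let E : (X → ℝ) →ₗ[ℝ] (J → ℝ) := Function.ExtendByZero.linearMap ℝ Subtype.val
  have hEinj : ∀ u, E u = 0 → u = 0 := fun u hu => by
    ext x
    have := congrFun hu x
    simpa [E, Subtype.val_injective.extend_apply] using this
  have hEsupp : ∀ u, ∀ x ∉ X, E u x = 0 := fun u x hx => by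
    simp only [E, Function.ExtendByZero.linearMap_apply]
    rw [Function.extend_apply' _ _ _ (by rintro ⟨a, rfl⟩; exact hx a.2)]
    rfl
  let T : ((X → ℝ) × (X → ℝ)) →ₗ[ℝ] (J → ℝ) :=
    ((B - r • LinearMap.id) ∘ₗ E).coprod ((B + r • LinearMap.id) ∘ₗ E)
  have hker : LinearMap.ker T ≠ ⊥ := by
    apply LinearMap.ker_ne_bot_of_finrank_lt
    simp only [Module.finrank_prod, Module.finrank_fintype_fun_eq_card, Fintype.card_coe]
    omega
  obtain ⟨⟨a, b⟩, hab, hne⟩ := Submodule.exists_mem_ne_zero_of_ne_bot hker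
  have hT : B (E a) - r • E a + (B (E b) + r • E b) = 0 := by
    simpa [T] using hab
  have hBT := congrArg B hT
  simp only [map_add, map_sub, map_smul, hB, map_zero] at hBT
  have ha : B (E a) = r • E a := by
    ext x
    have h1 := congrFun hT x
    have h2 := congrFun hBT x
    simp only [Pi.add_apply, Pi.sub_apply, Pi.smul_apply, smul_eq_mul, Pi.zero_apply] at h1 h2 ⊢
    have h3 : (2 * r) * (B (E a) x - r * E a x) = 0 := by linear_combination r * h1 - h2
    have h4 := (mul_eq_zero.mp h3).resolve_left (by simpa using hr)
    linarith
  by_cases ha0 : a = 0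
  · have hb0 : b ≠ 0 := fun hb => hne (by simp [ha0, hb])
    refine ⟨E b, fun h => hb0 (hEinj b h), hEsupp b, Or.inr ?_⟩
    subst ha0
    simp only [map_zero, smul_zero, sub_zero, zero_add] at hT
    rw [neg_smul]
    exact eq_neg_of_add_eq_zero_left hT
  · exact ⟨E a, fun h => ha0 (hEinj a h), hEsupp a, Or.inl ha⟩

/-- If `g` correlates with parity, then after twisting by parity one of its two fibres occupies
more than half of the cube. -/
lemma exists_large_twisted_fibre {I : Type*} [Fintype I] [DecidableEq I] [Nonempty I]
    (g : (I → Bool) → Bool)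
    (hg : ∑ x, parityChar x * (if g x then (1 : ℝ) else 0) ≠ 0) :
    ∃ X : Finset (I → Bool), Fintype.card (I → Bool) < 2 * X.card ∧
      ∀ x ∈ X, ∀ i, flipBit i x ∈ X → g x ≠ g (flipBit i x) := by
  classical
  set s : (I → Bool) → ℝ := fun x => parityChar x * bitSign (g x) with hs
  have hs1 : ∀ x, s x = 1 ∨ s x = -1 := fun x => by
    refine mul_self_eq_one_iff.mp ?_
    have h1 : parityChar x * parityChar x = 1 := prod_bitSign_mul_self _ x
    calc s x * s x = (parityChar x * parityChar x) * (bitSign (g x) * bitSign (g x)) := by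
          simp only [hs]; ring
      _ = 1 := by rw [h1, bitSign_mul_self, one_mul]
  have hflip : ∀ x i, s (flipBit i x) = s x → g x ≠ g (flipBit i x) := fun x i h hgx => by
    simp only [hs, parityChar_flipBit, ← hgx] at h
    have : s x = 0 := by simp only [hs]; linarith
    rcases hs1 x with h | h <;> rw [h] at this <;> norm_num at this
  have hsum : ∑ x, s x ≠ 0 := fun h => hg <| by
    have h2 : ∀ x, s x = parityChar x - 2 * (parityChar x * (if g x then (1 : ℝ) else 0)) :=
      fun x => by
        simp only [hs, bitSign]
        split_ifs <;> ring
    simp only [h2, Finset.sum_sub_distrib, sum_parityChar, ← Finset.mul_sum] at h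
    linarith
  set P := Finset.univ.filter fun x => s x = 1 with hP
  set N := Finset.univ.filter fun x => ¬ s x = 1 with hN
  have hcard : P.card + N.card = Fintype.card (I → Bool) :=
    Finset.card_filter_add_card_filter_not _
  have hdiff : ∑ x, s x = P.card - N.card := by
    rw [← Finset.sum_filter_add_sum_filter_not Finset.univ (fun x => s x = 1) s,
      Finset.sum_congr rfl (g := fun _ => (1 : ℝ)) (fun x hx => (Finset.mem_filter.mp hx).2),
      Finset.sum_congr (s₁ := Finset.univ.filter fun x => ¬ s x = 1) rfl (g := fun _ => (-1 : ℝ))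
        (fun x hx => (hs1 x).resolve_left (Finset.mem_filter.mp hx).2)]
    simp [← hP, ← hN, sub_eq_add_neg]
  have hPN : P.card ≠ N.card := fun h => hsum (by rw [hdiff, h, sub_self])
  rcases lt_or_gt_of_ne hPN with h | h
  · refine ⟨N, by omega, fun x hx i hi => hflip x i ?_⟩
    rw [(hs1 x).resolve_left (Finset.mem_filter.mp hx).2,
      (hs1 _).resolve_left (Finset.mem_filter.mp hi).2]
  · refine ⟨P, by omega, fun x hx i hi => hflip x i ?_⟩
    rw [(Finset.mem_filter.mp hx).2, (Finset.mem_filter.mp hi).2]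

/-- A function correlated with parity has a nonzero nonnegative vector witnessing that its
sensitivity graph has spectral radius at least `√d`. -/
lemma exists_nonneg_sqrt_card_le {I : Type*} [Fintype I] [LinearOrder I] [Nonempty I]
    (g : (I → Bool) → Bool)
    (hg : ∑ x, parityChar x * (if g x then (1 : ℝ) else 0) ≠ 0) :
    ∃ w : (I → Bool) → ℝ, w ≠ 0 ∧ (∀ x, 0 ≤ w x) ∧
      ∀ x, √(Fintype.card I) * w x ≤
        ∑ i, if g x ≠ g (flipBit i x) then w (flipBit i x) else 0 := by
  obtain ⟨X, hX, hXg⟩ := exists_large_twisted_fibre g hg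
  have hpos : (0 : ℝ) < Fintype.card I := by exact_mod_cast Fintype.card_pos
  obtain ⟨v, hv0, hvX, hv⟩ := exists_supported_eigenvector (signedAdj I)
    (Real.sqrt_pos.mpr hpos).ne'
    (fun v => by rw [Real.sq_sqrt hpos.le]; exact signedAdj_signedAdj v) X hX
  have hnn : ∀ x, 0 ≤ ∑ i, if g x ≠ g (flipBit i x) then |v (flipBit i x)| else 0 := fun x =>
    Finset.sum_nonneg fun i _ => by split_ifs <;> positivity
  refine ⟨fun x => |v x|, fun h => hv0 ?_, fun x => abs_nonneg _, fun x => ?_⟩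
  · ext x
    simpa using congrFun h x
  by_cases hx : x ∈ X
  · have habs : √(Fintype.card I) * |v x| = |signedAdj I v x| := by
      rcases hv with h | h <;> simp [h, abs_mul, abs_of_nonneg (Real.sqrt_nonneg _)]
    change √(Fintype.card I) * |v x| ≤ _
    rw [habs, signedAdj_apply]
    refine (Finset.abs_sum_le_sum_abs _ _).trans (Finset.sum_le_sum fun i _ => ?_)
    rw [abs_mul, abs_edgeSign, one_mul]
    split_ifs with h
    · exact le_rfl
    · rw [hvX _ fun hi => h (hXg x hx i hi), abs_zero]
  · simpa [hvX x hx] using hnn x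

lemma quadForm_le_specNorm {J K : Type*} [Fintype J] [Fintype K] [DecidableEq K]
    (M : Matrix K K ℝ) {e : J → K} (he : Function.Injective e) (u : J → ℝ) :
    ∑ x, u x * ∑ y, M (e x) (e y) * u y ≤ specNorm M * ∑ x, u x ^ 2 := by
  classical
  set w : K → ℝ := Function.extend e u 0
  have hwe : ∀ x, w (e x) = u x := fun x => he.extend_apply u (0 : K → ℝ) x
  have hsum : ∀ F : K → ℝ, (∀ k, w k = 0 → F k = 0) → ∑ k, F k = ∑ x, F (e x) := fun F hF => by
    refine (Finset.sum_of_injOn e he.injOn (by simp) (fun k _ hk => hF k ?_) fun _ _ => rfl).symm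
    exact Function.extend_apply' u (0 : K → ℝ) k (by simpa using hk)
  have hnorm : ‖WithLp.toLp 2 w‖ ^ 2 = ∑ x, u x ^ 2 := by
    rw [EuclideanSpace.real_norm_sq_eq, hsum _ (fun k hk => by simp [hk])]
    simp [hwe]
  have hin : inner ℝ (WithLp.toLp 2 w) (Matrix.toEuclideanCLM (𝕜 := ℝ) M (WithLp.toLp 2 w)) =
      ∑ x, u x * ∑ y, M (e x) (e y) * u y := by
    rw [Matrix.toEuclideanCLM_toLp, PiLp.inner_apply, hsum _ (fun k hk => by simp [hk])]
    refine Finset.sum_congr rfl fun x _ => ?_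
    have : (M.mulVec w) (e x) = ∑ y, M (e x) (e y) * u y := by
      rw [Matrix.mulVec, dotProduct, hsum _ (fun k hk => by simp [hk])]
      simp [hwe]
    simp [this, hwe, mul_comm]
  rw [← hin, ← hnorm, specNorm]
  calc _ ≤ ‖WithLp.toLp 2 w‖ * ‖Matrix.toEuclideanCLM (𝕜 := ℝ) M (WithLp.toLp 2 w)‖ :=
        real_inner_le_norm _ _
    _ ≤ ‖WithLp.toLp 2 w‖ * (‖Matrix.toEuclideanCLM (𝕜 := ℝ) M‖ * ‖WithLp.toLp 2 w‖) := by
        gcongr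
        exact ContinuousLinearMap.le_opNorm _ _
    _ = _ := by ring

/-- The embedding of the subcube on the coordinates `S`, all others being `false`. -/
def subcube {I : Type*} [DecidableEq I] (S : Finset I) (x : S → Bool) : I → Bool :=
  fun j => if h : j ∈ S then x ⟨j, h⟩ else false

lemma subcube_injective {I : Type*} [DecidableEq I] (S : Finset I) :
    Function.Injective (subcube S) := by
  intro x y h
  ext ⟨j, hj⟩
  simpa [subcube, hj] using congrFun h j

lemma subcube_flipBit {I : Type*} [DecidableEq I] (S : Finset I) (i : S) (x : S → Bool) :
    subcube S (flipBit i x) = flipBit (i : I) (subcube S x) := by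
  ext j
  by_cases hj : j ∈ S
  · by_cases hji : j = i
    · subst hji; simp [subcube, flipBit]
    · have : (⟨j, hj⟩ : S) ≠ i := fun h => hji (congrArg Subtype.val h)
      simp [subcube, flipBit, hj, hji, this]
  · have : j ≠ i := fun h => hj (h ▸ i.2)
    simp [subcube, flipBit, hj, this]

lemma card_le_specSens_sq {I : Type*} [Fintype I] [LinearOrder I] (f : (I → Bool) → Bool)
    (S : Finset I)
    (hS : ∑ x : S → Bool, parityChar x * (if f (subcube S x) then (1 : ℝ) else 0) ≠ 0) :
    (S.card : ℝ) ≤ specSens f ^ 2 := by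
  rcases S.eq_empty_or_nonempty with rfl | hne
  · simpa using sq_nonneg (specSens f)
  have : Nonempty S := hne.to_subtype
  obtain ⟨w, hw0, hwnn, hw⟩ := exists_nonneg_sqrt_card_le (fun x => f (subcube S x)) hS
  have hpos : 0 < ∑ x, w x ^ 2 := by
    obtain ⟨x, hx⟩ := Function.ne_iff.mp hw0
    exact Finset.sum_pos' (fun _ _ => sq_nonneg _)
      ⟨x, Finset.mem_univ x, pow_pos (lt_of_le_of_ne (hwnn x) (Ne.symm hx)) 2⟩
  have hA : ∀ x y, 0 ≤ sensAdj f x y := fun x y => by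
    simp only [sensAdj, Matrix.of_apply]
    split_ifs <;> norm_num
  have hle : ∀ x, √S.card * w x ≤ ∑ y, sensAdj f (subcube S x) (subcube S y) * w y := fun x => by
    have h := hw x
    rw [Fintype.card_coe] at h
    refine h.trans ?_
    calc _ = ∑ i, sensAdj f (subcube S x) (subcube S (flipBit i x)) * w (flipBit i x) := by
          refine Finset.sum_congr rfl fun i _ => ?_
          simp only [sensAdj, Matrix.of_apply, subcube_flipBit, hammingDist_flipBit, true_and,
            ite_mul, one_mul, zero_mul]
          rw [← subcube_flipBit]
          congr
      _ = ∑ y ∈ Finset.univ.image fun i => flipBit i x,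
            sensAdj f (subcube S x) (subcube S y) * w y :=
          (Finset.sum_image (f := fun y => sensAdj f (subcube S x) (subcube S y) * w y)
            (flipBit_left_injective x).injOn).symm
      _ ≤ _ := Finset.sum_le_sum_of_subset_of_nonneg (Finset.subset_univ _)
          fun y _ _ => mul_nonneg (hA _ _) (hwnn y)
  have hquad : √S.card * ∑ x, w x ^ 2 ≤ specSens f * ∑ x, w x ^ 2 := by
    refine le_trans ?_ (quadForm_le_specNorm (sensAdj f) (subcube_injective S) w)
    rw [Finset.mul_sum]
    refine Finset.sum_le_sum fun x _ => ?_
    calc √S.card * w x ^ 2 = w x * (√S.card * w x) := by ring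
      _ ≤ _ := mul_le_mul_of_nonneg_left (hle x) (hwnn x)
  have hsqrt := le_of_mul_le_mul_right hquad hpos
  calc (S.card : ℝ) = √S.card ^ 2 := (Real.sq_sqrt (Nat.cast_nonneg _)).symm
    _ ≤ _ := pow_le_pow_left₀ (Real.sqrt_nonneg _) hsqrt 2

/-- Boolean Möbius inversion over the subsets of a finite set. -/
lemma sum_powerset_moebius {I : Type*} [DecidableEq I] (F : Finset I → ℝ) (T : Finset I) :
    ∑ S ∈ T.powerset, (-1 : ℝ) ^ S.card * ∑ U ∈ S.powerset, (-1 : ℝ) ^ U.card * F U = F T := by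
  have hinner : ∀ U ∈ T.powerset, ∑ S ∈ Finset.Icc U T, (-1 : ℝ) ^ S.card =
      if U = T then (-1 : ℝ) ^ T.card else 0 := fun U hU => by
    have hUT := Finset.mem_powerset.mp hU
    have hdisj : ∀ V ∈ (T \ U).powerset, Disjoint U V := fun V hV =>
      Finset.disjoint_of_subset_right (Finset.mem_powerset.mp hV) Finset.disjoint_sdiff
    rw [Finset.Icc_eq_image_powerset hUT, Finset.sum_image]
    · have hz := Finset.sum_powerset_neg_one_pow_card (x := T \ U)
      have hzR : ∑ V ∈ (T \ U).powerset, (-1 : ℝ) ^ V.card = if T \ U = ∅ then 1 else 0 := by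
        exact_mod_cast congrArg (Int.cast : ℤ → ℝ) hz
      rw [Finset.sum_congr rfl fun V hV => by
        rw [Finset.card_union_of_disjoint (hdisj V hV), pow_add], ← Finset.mul_sum, hzR]
      by_cases h : U = T
      · simp [h]
      · have : T \ U ≠ ∅ := fun h' => h (hUT.antisymm (Finset.sdiff_eq_empty_iff_subset.mp h'))
        simp [h, this]
    · intro V hV W hW hVW
      rw [← Finset.union_sdiff_cancel_left (hdisj V hV),
        ← Finset.union_sdiff_cancel_left (hdisj W hW)]
      exact congrArg (· \ U) hVW
  simp only [Finset.mul_sum]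
  rw [Finset.sum_comm' (t' := T.powerset) (s' := fun U => Finset.Icc U T)]
  · calc _ = ∑ U ∈ T.powerset, (if U = T then (-1 : ℝ) ^ T.card else 0) *
          ((-1 : ℝ) ^ U.card * F U) := by
          refine Finset.sum_congr rfl fun U hU => ?_
          rw [← hinner U hU, Finset.sum_mul]
      _ = (-1 : ℝ) ^ T.card * ((-1 : ℝ) ^ T.card * F T) := by simp
      _ = F T := by rw [← mul_assoc, ← mul_pow]; simp
  · intro S U
    simp only [Finset.mem_powerset, Finset.mem_Icc]
    exact ⟨fun h => ⟨⟨h.2, h.1⟩, h.2.trans h.1⟩, fun h => ⟨h.1.2, h.1.1⟩⟩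

lemma sum_powerset_eq_sum_subcube {I : Type*} [DecidableEq I]
    (f : (I → Bool) → Bool) (S : Finset I) :
    ∑ U ∈ S.powerset, (-1 : ℝ) ^ U.card * (if f (fun i => decide (i ∈ U)) then 1 else 0) =
      ∑ x : S → Bool, parityChar x * (if f (subcube S x) then (1 : ℝ) else 0) := by
  symm
  refine Finset.sum_nbij' (fun x => S.filter fun i => subcube S x i = true)
    (fun U i => decide ((i : I) ∈ U)) (by simp) (by simp) ?_ ?_ ?_
  · intro x _
    ext i
    simp [subcube]
  · intro U hU
    ext i
    have hUS : i ∈ U → i ∈ S := fun h => Finset.mem_powerset.mp hU h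
    by_cases hi : i ∈ S
    · simp [subcube, hi]
    · simpa [subcube, hi] using fun h => hi (hUS h)
  · intro x _
    have h1 : (fun i => decide (i ∈ S.filter fun i => subcube S x i = true)) = subcube S x := by
      ext i
      by_cases hi : i ∈ S <;> simp [subcube, hi]
    have h2 : parityChar x = (-1 : ℝ) ^ (S.filter fun i => subcube S x i = true).card := by
      rw [← Finset.prod_const, Finset.prod_filter, ← Finset.prod_coe_sort, parityChar]
      refine Finset.prod_congr rfl fun i _ => ?_
      simp [subcube, bitSign]
    rw [h1, h2]

/-- For every `n ≥ 1` and every total Boolean function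
`f : {0,1}^n → {0,1}`, `deg(f) ≤ λ(f)²`. -/
theorem degB_le_specSens_sq (n : ℕ) (hn : 1 ≤ n) (f : (Fin n → Bool) → Bool) :
    (degB f : ℝ) ≤ specSens f ^ 2 := by
  set c : Finset (Fin n) → ℝ := fun S => (-1 : ℝ) ^ S.card * ∑ U ∈ S.powerset,
    (-1 : ℝ) ^ U.card * (if f (fun i => decide (i ∈ U)) then 1 else 0) with hc
  have hcard : ∀ S, c S ≠ 0 → (S.card : ℝ) ≤ specSens f ^ 2 := fun S hS =>
    card_le_specSens_sq f S (by
      rw [← sum_powerset_eq_sum_subcube]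
      exact right_ne_zero_of_mul hS)
  set p : MvPolynomial (Fin n) ℝ :=
    ∑ S : Finset (Fin n), MvPolynomial.C (c S) * ∏ i ∈ S, MvPolynomial.X i with hp
  have hdeg : degB f ≤ p.totalDegree := by
    refine Nat.sInf_le ⟨p, rfl, fun x => ?_⟩
    set T := Finset.univ.filter fun i => x i = true with hT
    have hTx : (fun i => decide (i ∈ T)) = x := by
      ext i
      simp [hT]
    have hmono : ∀ S : Finset (Fin n),
        ∏ i ∈ S, (if x i then (1 : ℝ) else 0) = if S ∈ T.powerset then 1 else 0 := fun S => by
      rw [Finset.prod_ite_zero]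
      simp [hT, Finset.subset_iff]
    have h := sum_powerset_moebius
      (fun U => if f (fun i => decide (i ∈ U)) then (1 : ℝ) else 0) T
    rw [hTx] at h
    simp only [hp, map_sum, map_mul, map_prod, MvPolynomial.eval_C, MvPolynomial.eval_X, hmono,
      mul_ite, mul_one, mul_zero]
    rw [← Finset.sum_filter, Finset.filter_univ_mem]
    exact h
  refine le_trans (Nat.cast_le.mpr (hdeg.trans ?_)) (Nat.floor_le (sq_nonneg (specSens f)))
  refine MvPolynomial.totalDegree_finsetSum_le fun S _ => ?_
  by_cases hS : c S = 0
  · simp [hS]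
  · refine (MvPolynomial.totalDegree_mul _ _).trans ?_
    rw [MvPolynomial.totalDegree_C, zero_add]
    refine (MvPolynomial.totalDegree_finsetProd _ _).trans ?_
    simpa using Nat.le_floor (hcard S hS)
end

section
/- Define the 2×2 matrix B_1 = [[0,1],[1,0]], and recursively for i ≥ 2 the 2^i × 2^i block matrix B_i = [[B_{i−1}, I],[I, −B_{i−1}]], where I is the identity matrix of size 2^{i−1}. Then for every n ≥ 1: (i) B_n² = n·I; (ii) B_n has eigenvalue +√n with multiplicity 2^{n−1} and eigenvalue −√n with multiplicity 2^{n−1}; in particular the trace of B_n is 0. -/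
/-- Huang's signed hypercube matrices: `Bmat 1 = [[0,1],[1,0]]` and
`Bmat (i+1) = [[Bmat i, I],[I, -Bmat i]]` (as a block matrix). `Bmat 0` is irrelevant. -/
noncomputable def Bmat : (i : ℕ) → Matrix (Fin (2 ^ i)) (Fin (2 ^ i)) ℝ
  | 0 => 0
  | 1 => Matrix.of fun x y => if x = y then 0 else 1
  | (i + 2) =>
      Matrix.reindex (finSumFinEquiv.trans (finCongr (by ring)))
        (finSumFinEquiv.trans (finCongr (by ring)))
        (Matrix.fromBlocks (Bmat (i + 1)) 1 1 (-(Bmat (i + 1))))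

/-- If `f ^ 2 = s ^ 2` with `s ≠ 0` and `f` has trace zero, then the eigenspace of `f` for `s`
has half the dimension of the whole space. -/
theorem two_mul_finrank_eigenspace_of_mul_self {K V : Type*} [Field K] [CharZero K]
    [AddCommGroup V] [Module K V] [FiniteDimensional K V] {f : Module.End K V} {s : K}
    (hs : s ≠ 0) (hf : f * f = (s * s) • (1 : Module.End K V))
    (htr : LinearMap.trace K V f = 0) :
    2 * Module.finrank K (Module.End.eigenspace f s) = Module.finrank K V := by
  have hff (x : V) : f (f x) = (s * s) • x := by
    simpa using LinearMap.congr_fun hf x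
  have hproj : LinearMap.IsProj (Module.End.eigenspace f s)
      ((2 * s)⁻¹ • (f + s • (1 : Module.End K V))) := by
    constructor
    · intro x
      rw [Module.End.mem_eigenspace_iff]
      simp only [LinearMap.smul_apply, LinearMap.add_apply, Module.End.one_apply, map_smul,
        map_add, hff]
      module
    · intro x hx
      rw [Module.End.mem_eigenspace_iff] at hx
      simp only [LinearMap.smul_apply, LinearMap.add_apply, Module.End.one_apply, hx]
      rw [← add_smul, ← two_mul, inv_smul_smul₀ (mul_ne_zero two_ne_zero hs)]
  have h := hproj.trace
  rw [map_smul, map_add, map_smul, htr, LinearMap.trace_one] at h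
  have h2 : (2 : K) * Module.finrank K (Module.End.eigenspace f s) = Module.finrank K V := by
    rw [← h]
    simp only [smul_eq_mul, zero_add]
    field_simp
  exact_mod_cast h2

theorem Matrix.trace_reindex_self {m n R : Type*} [Fintype m] [Fintype n] [AddCommMonoid R]
    (e : m ≃ n) (A : Matrix m m R) : (Matrix.reindex e e A).trace = A.trace :=
  e.symm.sum_comp fun i => A i i

theorem Bmat_one_eq : Bmat 1 = !![0, 1; 1, 0] := by
  ext i j
  fin_cases i <;> fin_cases j <;> simp [Bmat]

theorem Bmat_mul_self (n : ℕ) :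
    Bmat n * Bmat n = (n : ℝ) • (1 : Matrix (Fin (2 ^ n)) (Fin (2 ^ n)) ℝ) := by
  induction n using Nat.twoStepInduction with
  | zero => simp [Bmat]
  | one =>
    rw [Bmat_one_eq]
    ext i j
    fin_cases i <;> fin_cases j <;> simp [Matrix.mul_apply]
  | more i _ ih =>
    have hblock : Matrix.fromBlocks (Bmat (i + 1)) 1 1 (-Bmat (i + 1)) *
        Matrix.fromBlocks (Bmat (i + 1)) 1 1 (-Bmat (i + 1)) = ((i + 2 : ℕ) : ℝ) • 1 := by
      rw [Matrix.fromBlocks_multiply, ← Matrix.fromBlocks_one, Matrix.fromBlocks_smul]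
      simp only [mul_one, one_mul, neg_mul_neg, add_neg_cancel, smul_zero, ih]
      congr 1 <;> push_cast <;> module
    rw [Bmat, Matrix.reindex_apply, Matrix.submatrix_mul_equiv, hblock, Matrix.submatrix_smul,
      Pi.smul_apply, Pi.smul_apply, Matrix.submatrix_one_equiv]

theorem trace_Bmat (n : ℕ) : (Bmat n).trace = 0 := by
  match n with
  | 0 => simp [Bmat]
  | 1 => simp [Bmat, Matrix.trace]
  | i + 2 =>
    rw [Bmat, Matrix.trace_reindex_self]
    simp [Matrix.trace]

theorem finrank_eigenspace_Bmat {n : ℕ} (hn : 1 ≤ n) {s : ℝ} (hs : s * s = n) :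
    Module.finrank ℝ (Module.End.eigenspace (Matrix.mulVecLin (Bmat n)) s) = 2 ^ (n - 1) := by
  have hs0 : s ≠ 0 := by
    rintro rfl
    have : (n : ℝ) ≠ 0 := by positivity
    simp_all
  have hf : (Bmat n).mulVecLin * (Bmat n).mulVecLin =
      (s * s) • (1 : Module.End ℝ (Fin (2 ^ n) → ℝ)) := by
    rw [Module.End.mul_eq_comp, ← Matrix.mulVecLin_mul, Bmat_mul_self, hs]
    ext; simp
  have htr : LinearMap.trace ℝ (Fin (2 ^ n) → ℝ) (Bmat n).mulVecLin = 0 := by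
    rw [← Matrix.toLin'_apply', Matrix.trace_toLin'_eq, trace_Bmat]
  have h := two_mul_finrank_eigenspace_of_mul_self hs0 hf htr
  rw [Module.finrank_fin_fun] at h
  exact Nat.eq_of_mul_eq_mul_left two_pos (h.trans (mul_pow_sub_one (by lia) 2).symm)

/-- For every `n ≥ 1`: (i) `Bₙ² = n·I`; (ii) `Bₙ` has eigenvalue `√n`
with multiplicity `2^{n-1}` and eigenvalue `-√n` with multiplicity `2^{n-1}`;
in particular the trace of `Bₙ` is `0`. -/
theorem Bmat_props (n : ℕ) (hn : 1 ≤ n) :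
    Bmat n * Bmat n = (n : ℝ) • (1 : Matrix (Fin (2 ^ n)) (Fin (2 ^ n)) ℝ) ∧
    Module.finrank ℝ
      (Module.End.eigenspace (Matrix.mulVecLin (Bmat n)) (Real.sqrt n)) = 2 ^ (n - 1) ∧
    Module.finrank ℝ
      (Module.End.eigenspace (Matrix.mulVecLin (Bmat n)) (-Real.sqrt n)) = 2 ^ (n - 1) ∧
    Matrix.trace (Bmat n) = 0 := by
  have hs : √(n : ℝ) * √(n : ℝ) = n := Real.mul_self_sqrt n.cast_nonneg
  exact ⟨Bmat_mul_self n, finrank_eigenspace_Bmat hn hs,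
    finrank_eigenspace_Bmat hn (by rw [neg_mul_neg, hs]), trace_Bmat n⟩
end

section
/- There is a universal constant C > 0 such that for every n ≥ 1 and every total Boolean function f : {0,1}^n → {0,1}, deg(f) ≤ C · adeg(f)². -/
/-- Approximate degree of a Boolean function: minimum total degree of a real polynomial
approximating it pointwise to error 1/3 on the Boolean cube. -/
noncomputable def adegB {n : ℕ} (f : (Fin n → Bool) → Bool) : ℕ :=
  sInf {d | ∃ p : MvPolynomial (Fin n) ℝ, p.totalDegree = d ∧
    ∀ x : Fin n → Bool,
      |MvPolynomial.eval (fun i => if x i then (1 : ℝ) else 0) p - (if f x then 1 else 0)| ≤ 1/3}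

namespace BoolCube

variable {n : ℕ}

/-- Negate the `i`-th coordinate of a point of the cube. -/
def flip (i : Fin n) (x : Fin n → Bool) : Fin n → Bool := Function.update x i (!x i)

@[simp] theorem flip_same (i : Fin n) (x : Fin n → Bool) : flip i x i = !x i := by
  simp [flip]

theorem flip_of_ne {i j : Fin n} (h : j ≠ i) (x : Fin n → Bool) : flip i x j = x j := by
  simp [flip, h]

@[simp] theorem flip_flip (i : Fin n) (x : Fin n → Bool) : flip i (flip i x) = x := by
  simp [flip]

theorem flip_comm (i j : Fin n) (x : Fin n → Bool) : flip i (flip j x) = flip j (flip i x) := by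
  funext k
  by_cases hi : k = i <;> by_cases hj : k = j <;> simp_all [flip, Function.update_apply]

theorem sum_flip (i : Fin n) (F : (Fin n → Bool) → ℝ) : ∑ x, F (flip i x) = ∑ x, F x :=
  Equiv.sum_comp (Function.Involutive.toPerm (flip i) (flip_flip i)) F

/-- The sign `(-1)^b`. -/
def boolSign (b : Bool) : ℝ := if b then -1 else 1

@[simp] theorem boolSign_not (b : Bool) : boolSign (!b) = -boolSign b := by
  cases b <;> simp [boolSign]

@[simp] theorem boolSign_mul_self (b : Bool) : boolSign b * boolSign b = 1 := by
  cases b <;> simp [boolSign]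

/-- The Walsh character `x ↦ (-1)^{∑ i ∈ S, x i}`. -/
def walsh (S : Finset (Fin n)) (x : Fin n → Bool) : ℝ := ∏ i ∈ S, boolSign (x i)

theorem walsh_flip (S : Finset (Fin n)) (i : Fin n) (x : Fin n → Bool) :
    walsh S (flip i x) = (if i ∈ S then -1 else 1) * walsh S x := by
  unfold walsh
  split_ifs with h
  · rw [← Finset.mul_prod_erase S _ h, ← Finset.mul_prod_erase S (fun j => boolSign (x j)) h,
      flip_same, boolSign_not,
      Finset.prod_congr rfl fun j hj => by rw [flip_of_ne (Finset.ne_of_mem_erase hj)]]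
    ring
  · rw [one_mul]
    exact Finset.prod_congr rfl fun j hj => by
      rw [flip_of_ne (ne_of_mem_of_not_mem hj h)]

@[simp] theorem walsh_mul_self (S : Finset (Fin n)) (x : Fin n → Bool) :
    walsh S x * walsh S x = 1 := by
  simp [walsh, ← Finset.prod_mul_distrib]

theorem walsh_mul (S T : Finset (Fin n)) (x : Fin n → Bool) :
    walsh S x * walsh T x = walsh (symmDiff S T) x := by
  have key : ∀ U : Finset (Fin n), walsh U x = ∏ i, if i ∈ U then boolSign (x i) else 1 := by
    intro U; simp [walsh]
  rw [key, key, key, ← Finset.prod_mul_distrib]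
  refine Finset.prod_congr rfl fun i _ => ?_
  by_cases hS : i ∈ S <;> by_cases hT : i ∈ T <;> simp [Finset.mem_symmDiff, hS, hT]

theorem sum_mul_walsh_eq_zero {U : Finset (Fin n)} {i : Fin n} (hi : i ∈ U)
    {F : (Fin n → Bool) → ℝ} (hF : ∀ x, F (flip i x) = F x) : ∑ x, F x * walsh U x = 0 := by
  have h := sum_flip i fun x => F x * walsh U x
  simp only [hF, walsh_flip, hi, if_true, mul_neg, neg_mul, one_mul, Finset.sum_neg_distrib] at h
  linarith

theorem sum_walsh_eq_zero {U : Finset (Fin n)} (hU : U.Nonempty) : ∑ x, walsh U x = 0 := by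
  obtain ⟨i, hi⟩ := hU
  simpa using sum_mul_walsh_eq_zero hi (F := fun _ => 1) fun _ => rfl

theorem sum_walsh_mul_walsh (S T : Finset (Fin n)) :
    ∑ x, walsh S x * walsh T x = if S = T then (2 : ℝ) ^ n else 0 := by
  split_ifs with h
  · simp [h]
  · simp only [walsh_mul]
    exact sum_walsh_eq_zero (Finset.symmDiff_nonempty.mpr h)

theorem sum_walsh_mul_walsh_apply (x y : Fin n → Bool) :
    ∑ S, walsh S x * walsh S y = if x = y then (2 : ℝ) ^ n else 0 := by
  have h : ∑ S, walsh S x * walsh S y = ∏ i, (1 + boolSign (x i) * boolSign (y i)) := by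
    simp only [walsh, ← Finset.prod_mul_distrib]
    rw [Finset.prod_one_add, Finset.powerset_univ]
  rw [h]
  split_ifs with hxy
  · subst hxy
    simp only [boolSign_mul_self]
    norm_num
  · obtain ⟨i, hi⟩ := Function.ne_iff.mp hxy
    refine Finset.prod_eq_zero (Finset.mem_univ i) ?_
    cases hx : x i <;> cases hy : y i <;> simp_all [boolSign]

/-- The function on the cube with given Walsh coefficients. -/
def synth (a : Finset (Fin n) → ℝ) (x : Fin n → Bool) : ℝ := ∑ S, a S * walsh S x

/-- The Walsh coefficients of a function on the cube. -/
noncomputable def coeff (u : (Fin n → Bool) → ℝ) (S : Finset (Fin n)) : ℝ :=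
  (∑ x, u x * walsh S x) / 2 ^ n

theorem synth_coeff (u : (Fin n → Bool) → ℝ) : synth (coeff u) = u := by
  funext x
  have h : ∀ S, coeff u S * walsh S x = ∑ y, u y / 2 ^ n * (walsh S y * walsh S x) := by
    intro S
    rw [coeff, Finset.sum_div, Finset.sum_mul]
    exact Finset.sum_congr rfl fun y _ => by ring
  simp only [synth, h]
  rw [Finset.sum_comm]
  simp [← Finset.mul_sum, sum_walsh_mul_walsh_apply]

theorem sum_synth_mul (q : (Fin n → Bool) → ℝ) (a b : Finset (Fin n) → ℝ) :
    ∑ x, synth a x * q x * synth b x =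
      ∑ S, ∑ T, a S * b T * ∑ x, q x * walsh (symmDiff S T) x := by
  have h : ∀ x, synth a x * q x * synth b x =
      ∑ S, ∑ T, a S * b T * (q x * walsh (symmDiff S T) x) := by
    intro x
    rw [mul_right_comm, synth, synth, Finset.sum_mul_sum, Finset.sum_mul]
    refine Finset.sum_congr rfl fun S _ => ?_
    rw [Finset.sum_mul]
    refine Finset.sum_congr rfl fun T _ => ?_
    rw [← walsh_mul]
    ring
  simp only [h, Finset.mul_sum]
  rw [Finset.sum_comm]
  exact Finset.sum_congr rfl fun S _ => Finset.sum_comm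

theorem sum_synth_sq (a : Finset (Fin n) → ℝ) : ∑ x, synth a x ^ 2 = 2 ^ n * ∑ S, a S ^ 2 := by
  have h := sum_synth_mul 1 a a
  simp only [Pi.one_apply, one_mul, ← walsh_mul, sum_walsh_mul_walsh, mul_one] at h
  simp only [sq, h, Finset.mul_sum]
  simp [mul_comm]

theorem sum_synth_flip (a : Finset (Fin n) → ℝ) (x : Fin n → Bool) :
    ∑ i, synth a (flip i x) = synth (fun S => (n - 2 * S.card) * a S) x := by
  simp only [synth, walsh_flip]
  rw [Finset.sum_comm]
  refine Finset.sum_congr rfl fun S _ => ?_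
  have h : ∑ i : Fin n, (if i ∈ S then (-1 : ℝ) else 1) = n - 2 * S.card := by
    have : ∀ i : Fin n, (if i ∈ S then (-1 : ℝ) else 1) = 1 - 2 * if i ∈ S then 1 else 0 := by
      intro i; split_ifs <;> norm_num
    simp only [this, Finset.sum_sub_distrib, ← Finset.mul_sum]
    simp
  rw [← Finset.mul_sum, ← Finset.sum_mul, h]
  ring

/-- Restriction of Walsh coefficients to the levels `k` with `m ∈ [k + α, k + α + d)`. -/
def window (d α m : ℕ) (a : Finset (Fin n) → ℝ) (S : Finset (Fin n)) : ℝ :=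
  if m ∈ Finset.Ico (S.card + α) (S.card + α + d) then a S else 0

theorem sum_window_sq_le (d α R : ℕ) (a : Finset (Fin n) → ℝ) :
    ∑ m ∈ Finset.range R, ∑ x, synth (window d α m a) x ^ 2 ≤ d * ∑ x, synth a x ^ 2 := by
  simp only [sum_synth_sq, ← Finset.mul_sum]
  rw [Finset.sum_comm, mul_left_comm, Finset.mul_sum (a := (d : ℝ))]
  refine mul_le_mul_of_nonneg_left (Finset.sum_le_sum fun S _ => ?_) (by positivity)
  have h : ∀ m, window d α m a S ^ 2 =
      (if m ∈ Finset.Ico (S.card + α) (S.card + α + d) then 1 else 0) * a S ^ 2 := by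
    intro m; unfold window; split_ifs <;> simp
  simp only [h, ← Finset.sum_mul]
  refine mul_le_mul_of_nonneg_right ?_ (sq_nonneg _)
  rw [Finset.sum_ite_mem, Finset.sum_const, nsmul_one, Nat.cast_le]
  exact (Finset.card_le_card Finset.inter_subset_right).trans (by simp)

theorem abs_sum_window_le {q : (Fin n → Bool) → ℝ} {M : ℝ} (hM : ∀ x, |q x| ≤ M)
    (d α β R : ℕ) (a b : Finset (Fin n) → ℝ) :
    |∑ m ∈ Finset.range R, ∑ x, synth (window d α m a) x * q x * synth (window d β m b) x| ≤
      d * M * ((∑ x, synth a x ^ 2) + ∑ x, synth b x ^ 2) / 2 := by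
  have hM0 : 0 ≤ M := (abs_nonneg _).trans (hM fun _ => false)
  have hpt : ∀ m x, |synth (window d α m a) x * q x * synth (window d β m b) x| ≤
      M / 2 * (synth (window d α m a) x ^ 2 + synth (window d β m b) x ^ 2) := by
    intro m x
    set s := synth (window d α m a) x
    set t := synth (window d β m b) x
    have h1 : |s * q x * t| = |q x| * (|s| * |t|) := by rw [abs_mul, abs_mul]; ring
    have h2 : |q x| * (|s| * |t|) ≤ M * (|s| * |t|) :=
      mul_le_mul_of_nonneg_right (hM x) (by positivity)
    nlinarith [mul_nonneg hM0 (sq_nonneg (|s| - |t|)), sq_abs s, sq_abs t]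
  calc _ ≤ ∑ m ∈ Finset.range R, ∑ x,
        M / 2 * (synth (window d α m a) x ^ 2 + synth (window d β m b) x ^ 2) :=
        (Finset.abs_sum_le_sum_abs _ _).trans <| Finset.sum_le_sum fun m _ =>
          (Finset.abs_sum_le_sum_abs _ _).trans <| Finset.sum_le_sum fun x _ => hpt m x
    _ = M / 2 * (∑ m ∈ Finset.range R, ∑ x, synth (window d α m a) x ^ 2 +
          ∑ m ∈ Finset.range R, ∑ x, synth (window d β m b) x ^ 2) := by
        simp only [← Finset.mul_sum, Finset.sum_add_distrib]
    _ ≤ M / 2 * (d * ∑ x, synth a x ^ 2 + d * ∑ x, synth b x ^ 2) := by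
        gcongr <;> exact sum_window_sq_le ..
    _ = _ := by ring

theorem sum_window_indicator {d s t R : ℕ} (hst : s ≤ t + d) (hts : t ≤ s + d)
    (hs : s + 2 * d ≤ R) (ht : t + 2 * d ≤ R) :
    ∑ m ∈ Finset.range R,
      (((if m ∈ Finset.Ico (s + d) (s + d + d) then (1 : ℝ) else 0) *
          (if m ∈ Finset.Ico (t + 0) (t + 0 + d) then 1 else 0)) -
        (if m ∈ Finset.Ico (s + 0) (s + 0 + d) then 1 else 0) *
          (if m ∈ Finset.Ico (t + d) (t + d + d) then 1 else 0)) = (t : ℝ) - s := by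
  have key : ∀ A B : Finset ℕ, A ⊆ Finset.range R →
      ∑ m ∈ Finset.range R, (if m ∈ A then (1 : ℝ) else 0) * (if m ∈ B then 1 else 0) =
        (A ∩ B).card := by
    intro A B hA
    simp only [mul_ite, mul_one, mul_zero]
    have : ∀ m, (if m ∈ B then if m ∈ A then (1 : ℝ) else 0 else 0) =
        if m ∈ A ∩ B then 1 else 0 := by
      intro m; by_cases m ∈ A <;> by_cases m ∈ B <;> simp_all
    simp only [this]
    rw [Finset.sum_ite_mem, Finset.inter_eq_right.mpr (Finset.inter_subset_left.trans hA)]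
    simp
  rw [Finset.sum_sub_distrib, key, key, Finset.Ico_inter_Ico, Finset.Ico_inter_Ico,
    Nat.card_Ico, Nat.card_Ico, sub_eq_sub_iff_add_eq_add]
  · norm_cast
    simp only [max_def, min_def]
    split_ifs <;> omega
  · intro m; simp only [Finset.mem_Ico, Finset.mem_range]; omega
  · intro m; simp only [Finset.mem_Ico, Finset.mem_range]; omega

theorem card_le_card_add_card_symmDiff (S T : Finset (Fin n)) :
    S.card ≤ T.card + (symmDiff S T).card := by
  refine (Finset.card_le_card (t := T ∪ symmDiff S T) fun i hi => ?_).trans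
    (Finset.card_union_le _ _)
  by_cases hT : i ∈ T <;> simp [Finset.mem_symmDiff, hi, hT]

/-- A function of Walsh degree `d` bounded by `M` has a commutator with the adjacency operator
of the cube of norm at most `4 d M`; here in its bilinear form. -/
theorem sum_commutator_le {q : (Fin n → Bool) → ℝ} {M : ℝ} {d : ℕ} (hM : ∀ x, |q x| ≤ M)
    (hq : ∀ U : Finset (Fin n), d < U.card → ∑ x, q x * walsh U x = 0)
    (u v : (Fin n → Bool) → ℝ) :
    ∑ x, ∑ i, u x * v (flip i x) * (q (flip i x) - q x) ≤
      2 * d * M * ((∑ x, u x ^ 2) + ∑ x, v x ^ 2) := by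
  obtain ⟨a, rfl⟩ : ∃ a, synth a = u := ⟨_, synth_coeff u⟩
  obtain ⟨b, rfl⟩ : ∃ b, synth b = v := ⟨_, synth_coeff v⟩
  let c : Finset (Fin n) → Finset (Fin n) → ℝ := fun S T => ∑ x, q x * walsh (symmDiff S T) x
  have h1 : ∑ x, ∑ i, synth a x * synth b (flip i x) * q (flip i x) =
      ∑ S, ∑ T, (n - 2 * S.card) * a S * b T * c S T := by
    rw [← sum_synth_mul q (fun S => (n - 2 * S.card) * a S), Finset.sum_comm]
    have : ∀ i : Fin n, ∑ x, synth a x * synth b (flip i x) * q (flip i x) =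
        ∑ x, synth a (flip i x) * q x * synth b x := by
      intro i
      rw [← sum_flip i]
      exact Finset.sum_congr rfl fun x _ => by rw [flip_flip]; ring
    simp only [this]
    rw [Finset.sum_comm]
    simp only [← Finset.sum_mul, sum_synth_flip]
  have h2 : ∑ x, ∑ i, synth a x * synth b (flip i x) * q x =
      ∑ S, ∑ T, a S * ((n - 2 * T.card) * b T) * c S T := by
    rw [← sum_synth_mul q a (fun S => (n - 2 * S.card) * b S)]
    refine Finset.sum_congr rfl fun x _ => ?_
    rw [← sum_synth_flip, Finset.mul_sum]
    exact Finset.sum_congr rfl fun i _ => by ring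
  have h3 : ∑ x, ∑ i, synth a x * synth b (flip i x) * (q (flip i x) - q x) =
      2 * ∑ S, ∑ T, ((T.card : ℝ) - S.card) * (a S * b T * c S T) := by
    simp only [mul_sub, Finset.sum_sub_distrib, h1, h2]
    simp only [Finset.mul_sum, ← Finset.sum_sub_distrib]
    exact Finset.sum_congr rfl fun S _ => Finset.sum_congr rfl fun T _ => by ring
  let R := n + 2 * d
  have h4 : ∑ S, ∑ T, ((T.card : ℝ) - S.card) * (a S * b T * c S T) =
      ∑ m ∈ Finset.range R, (∑ x, synth (window d d m a) x * q x * synth (window d 0 m b) x) -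
      ∑ m ∈ Finset.range R, ∑ x, synth (window d 0 m a) x * q x * synth (window d d m b) x := by
    simp only [sum_synth_mul, ← Finset.sum_sub_distrib]
    symm
    rw [Finset.sum_comm]
    refine Finset.sum_congr rfl fun S _ => ?_
    rw [Finset.sum_comm]
    refine Finset.sum_congr rfl fun T _ => Eq.symm ?_
    by_cases hd : d < (symmDiff S T).card
    · simp [c, hq _ hd]
    have hS := card_le_card_add_card_symmDiff S T
    have hT := card_le_card_add_card_symmDiff T S
    rw [symmDiff_comm] at hT
    have hSn : S.card ≤ n := by simpa using S.card_le_univ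
    have hTn : T.card ≤ n := by simpa using T.card_le_univ
    rw [← sum_window_indicator (d := d) (s := S.card) (t := T.card) (R := R)
      (by omega) (by omega) (by omega) (by omega), Finset.sum_mul]
    refine Finset.sum_congr rfl fun m _ => ?_
    have hw : ∀ (α : ℕ) (e : Finset (Fin n) → ℝ) (U : Finset (Fin n)), window d α m e U =
        (if m ∈ Finset.Ico (U.card + α) (U.card + α + d) then 1 else 0) * e U := by
      intro α e U; simp [window]
    simp only [hw, c]
    ring
  rw [h3, h4]
  have h5 := (abs_le.mp (abs_sum_window_le hM d d 0 R a b)).2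
  have h6 := (abs_le.mp (abs_sum_window_le hM d 0 d R a b)).1
  linarith

/-- Huang's signed adjacency operator of the cube, restricted to the edges in directions `S`. -/
def signedAdj (S : Finset (Fin n)) : ((Fin n → Bool) → ℝ) →ₗ[ℝ] ((Fin n → Bool) → ℝ) where
  toFun v x := ∑ i ∈ S, walsh (Finset.Iio i) x * v (flip i x)
  map_add' u v := by
    funext x; simp [mul_add, Finset.sum_add_distrib]
  map_smul' r v := by
    funext x
    simp only [Pi.smul_apply, smul_eq_mul, RingHom.id_apply, Finset.mul_sum]
    exact Finset.sum_congr rfl fun i _ => by ring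

theorem signedAdj_apply (S : Finset (Fin n)) (v : (Fin n → Bool) → ℝ) (x : Fin n → Bool) :
    signedAdj S v x = ∑ i ∈ S, walsh (Finset.Iio i) x * v (flip i x) := rfl

theorem signedAdj_signedAdj (S : Finset (Fin n)) (v : (Fin n → Bool) → ℝ) :
    signedAdj S (signedAdj S v) = (S.card : ℝ) • v := by
  funext x
  let F : Fin n → Fin n → ℝ := fun i j =>
    walsh (Finset.Iio i) x * (walsh (Finset.Iio j) (flip i x) * v (flip j (flip i x)))
  have hF : ∀ i j, F i j + F j i = if i = j then 2 * v x else 0 := by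
    intro i j
    simp only [F, walsh_flip, Finset.mem_Iio]
    rcases lt_trichotomy i j with h | rfl | h
    · simp only [h, h.not_gt, h.ne, if_true, if_false]
      rw [flip_comm j i]
      ring
    · simp only [lt_irrefl, if_true, if_false, flip_flip]
      linear_combination (2 * v x) * walsh_mul_self (Finset.Iio i) x
    · simp only [h, h.not_gt, h.ne', if_true, if_false]
      rw [flip_comm j i]
      ring
  have h2 : 2 * ∑ i ∈ S, ∑ j ∈ S, F i j = 2 * (S.card * v x) := by
    rw [two_mul]
    nth_rewrite 2 [Finset.sum_comm]
    simp only [← Finset.sum_add_distrib, hF, Finset.sum_ite_eq]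
    rw [Finset.sum_congr rfl fun i hi => if_pos hi]
    simp
    ring
  simp only [signedAdj_apply, Finset.mul_sum, Pi.smul_apply, smul_eq_mul]
  linarith

theorem exists_signedAdj_eigenvector (S : Finset (Fin n))
    {H : Finset (Fin n → Bool)} (hH : 2 ^ n < 2 * H.card) :
    ∃ v : (Fin n → Bool) → ℝ, v ≠ 0 ∧ (∀ x ∉ H, v x = 0) ∧
      ∃ r : ℝ, |r| = √S.card ∧ signedAdj S v = r • v := by
  set r := √(S.card : ℝ)
  have hr : r * r = S.card := Real.mul_self_sqrt (Nat.cast_nonneg _)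
  let L : ℝ → (((Fin n → Bool) → ℝ) →ₗ[ℝ] ((Fin n → Bool) → ℝ)) := fun t =>
    signedAdj S - t • LinearMap.id
  have hmem : ∀ t v, v ∈ LinearMap.ker (L t) ↔ signedAdj S v = t • v := by
    intro t v; simp [L, sub_eq_zero]
  have hle : LinearMap.range (L r) ≤ LinearMap.ker (L (-r)) := by
    rintro _ ⟨v, rfl⟩
    rw [hmem]
    simp only [L, LinearMap.sub_apply, LinearMap.smul_apply, LinearMap.id_apply, map_sub, map_smul,
      signedAdj_signedAdj, ← hr]
    module
  have hdim : 2 ^ n ≤ Module.finrank ℝ (LinearMap.ker (L (-r))) +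
      Module.finrank ℝ (LinearMap.ker (L r)) := by
    have h1 := LinearMap.finrank_range_add_finrank_ker (L r)
    have h2 := Submodule.finrank_mono hle
    simp at h1
    omega
  have hcompl : H.card + Hᶜ.card = 2 ^ n := by
    rw [Finset.card_add_card_compl]; simp
  have main : ∀ t, |t| = r → 2 ^ n ≤ 2 * Module.finrank ℝ (LinearMap.ker (L t)) →
      ∃ v : (Fin n → Bool) → ℝ, v ≠ 0 ∧ (∀ x ∉ H, v x = 0) ∧
        ∃ r' : ℝ, |r'| = r ∧ signedAdj S v = r' • v := by
    intro t ht hfin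
    let ρ : LinearMap.ker (L t) →ₗ[ℝ] ((Hᶜ : Finset (Fin n → Bool)) → ℝ) :=
      (LinearMap.funLeft ℝ ℝ Subtype.val).comp (LinearMap.ker (L t)).subtype
    have hker : LinearMap.ker ρ ≠ ⊥ := by
      apply LinearMap.ker_ne_bot_of_finrank_lt
      simp only [Module.finrank_fintype_fun_eq_card, Fintype.card_coe]
      omega
    obtain ⟨v, hv, hv0⟩ := (Submodule.ne_bot_iff _).mp hker
    refine ⟨v, fun h => hv0 (Subtype.ext h), fun x hx => ?_, t, ht, (hmem t v).mp v.2⟩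
    exact congrFun (LinearMap.mem_ker.mp hv) ⟨x, Finset.mem_compl.mpr hx⟩
  have hr0 : 0 ≤ r := Real.sqrt_nonneg _
  rcases le_total (Module.finrank ℝ (LinearMap.ker (L r)))
    (Module.finrank ℝ (LinearMap.ker (L (-r)))) with h | h
  · exact main (-r) (by rw [abs_neg, abs_of_nonneg hr0]) (by omega)
  · exact main r (abs_of_nonneg hr0) (by omega)

theorem exists_weight_of_card_lt (S : Finset (Fin n))
    {H : Finset (Fin n → Bool)} (hH : 2 ^ n < 2 * H.card) :
    ∃ w : (Fin n → Bool) → ℝ, (∀ x, 0 ≤ w x) ∧ (∀ x ∉ H, w x = 0) ∧ 0 < ∑ x, w x ^ 2 ∧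
      √S.card * ∑ x, w x ^ 2 ≤ ∑ x, ∑ i ∈ S, w x * w (flip i x) := by
  obtain ⟨v, hv0, hvH, r, hr, hv⟩ := exists_signedAdj_eigenvector S hH
  refine ⟨fun x => |v x|, fun x => abs_nonneg _, fun x hx => by simp [hvH x hx], ?_, ?_⟩
  · obtain ⟨x, hx⟩ := Function.ne_iff.mp hv0
    refine Finset.sum_pos' (fun _ _ => sq_nonneg _) ⟨x, Finset.mem_univ x, ?_⟩
    exact pow_pos (abs_pos.mpr hx) 2
  · rw [Finset.mul_sum]
    refine Finset.sum_le_sum fun x _ => ?_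
    have h1 : √(S.card : ℝ) * |v x| ≤ ∑ i ∈ S, |v (flip i x)| := by
      rw [← hr, ← abs_mul, ← smul_eq_mul, ← Pi.smul_apply, ← hv, signedAdj_apply]
      refine (Finset.abs_sum_le_sum_abs _ _).trans (Finset.sum_le_sum fun i _ => ?_)
      have : |walsh (Finset.Iio i) x| = 1 := by
        rw [← sq_eq_sq₀ (abs_nonneg _) zero_le_one, sq_abs, sq, walsh_mul_self, one_pow]
      rw [abs_mul, this, one_mul]
    rw [← Finset.mul_sum]
    nlinarith [abs_nonneg (v x)]

theorem exists_weight_of_coeff_ne_zero {S : Finset (Fin n)} {f : (Fin n → Bool) → Bool}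
    (hf : ∑ x, boolSign (f x) * walsh S x ≠ 0) :
    ∃ w : (Fin n → Bool) → ℝ, (∀ x, 0 ≤ w x) ∧ 0 < ∑ x, w x ^ 2 ∧
      √S.card * ∑ x, w x ^ 2 ≤
        ∑ x, ∑ i, if f x ≠ f (flip i x) then w x * w (flip i x) else 0 := by
  let g : (Fin n → Bool) → ℝ := fun x => boolSign (f x) * walsh S x
  have hg : ∀ x, g x * g x = 1 := fun x => by
    simp only [g]
    rw [mul_mul_mul_comm, boolSign_mul_self, walsh_mul_self, one_mul]
  obtain ⟨ε, hε, hpos⟩ : ∃ ε : ℝ, ε * ε = 1 ∧ 0 < ∑ x, ε * g x := by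
    rcases lt_or_gt_of_ne hf with h | h
    · exact ⟨-1, by norm_num, by rw [← Finset.mul_sum]; linarith⟩
    · exact ⟨1, by norm_num, by rw [← Finset.mul_sum]; linarith⟩
  let H : Finset (Fin n → Bool) := Finset.univ.filter fun x => ε * g x = 1
  have hval : ∀ x, ε * g x = 2 * (if ε * g x = 1 then 1 else 0) - 1 := by
    intro x
    have : (ε * g x) * (ε * g x) = 1 := by rw [mul_mul_mul_comm, hε, hg, one_mul]
    rcases mul_self_eq_one_iff.mp this with h | h <;> rw [h] <;> norm_num
  have hH : 2 ^ n < 2 * H.card := by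
    rw [Finset.sum_congr rfl fun x _ => hval x] at hpos
    simp only [Finset.sum_sub_distrib, ← Finset.mul_sum, Finset.sum_boole] at hpos
    simp at hpos
    exact_mod_cast hpos
  obtain ⟨w, hw0, hwH, hwpos, hw⟩ := exists_weight_of_card_lt S hH
  refine ⟨w, hw0, hwpos, hw.trans (Finset.sum_le_sum fun x _ => ?_)⟩
  have hle : ∀ i ∈ S, w x * w (flip i x) ≤
      if f x ≠ f (flip i x) then w x * w (flip i x) else 0 := by
    intro i hi
    split_ifs with h
    · exact le_rfl
    · push Not at h
      by_cases hx : x ∈ H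
      · have : flip i x ∉ H := by
          simp only [H, g, Finset.mem_filter, Finset.mem_univ, true_and, walsh_flip, hi, if_true,
            ← h] at hx ⊢
          linarith
        simp [hwH _ this]
      · simp [hwH x hx]
  refine (Finset.sum_le_sum hle).trans
    (Finset.sum_le_sum_of_subset_of_nonneg (Finset.subset_univ S) fun i _ _ => ?_)
  split_ifs
  · exact mul_nonneg (hw0 _) (hw0 _)
  · exact le_rfl

/-- The real point of `{0,1}^n` corresponding to a Boolean vector. -/
abbrev toReal (x : Fin n → Bool) : Fin n → ℝ := fun i => if x i then (1 : ℝ) else 0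

theorem sum_eval_mul_walsh_eq_zero (p : MvPolynomial (Fin n) ℝ) {U : Finset (Fin n)}
    (hU : p.totalDegree < U.card) :
    ∑ x : Fin n → Bool, MvPolynomial.eval (toReal x) p * walsh U x = 0 := by
  simp only [MvPolynomial.eval_eq, Finset.sum_mul]
  rw [Finset.sum_comm]
  refine Finset.sum_eq_zero fun m hm => ?_
  have hcard : m.support.card < U.card := by
    refine lt_of_le_of_lt ?_ hU
    refine le_trans ?_ (MvPolynomial.le_totalDegree hm)
    rw [Finset.card_eq_sum_ones]
    exact Finset.sum_le_sum fun i hi =>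
      Nat.one_le_iff_ne_zero.mpr (Finsupp.mem_support_iff.mp hi)
  obtain ⟨i, hi, him⟩ := Finset.exists_mem_notMem_of_card_lt_card hcard
  refine sum_mul_walsh_eq_zero hi fun x => ?_
  congr 1
  exact Finset.prod_congr rfl fun j hj => by
    simp only [toReal, flip_of_ne (ne_of_mem_of_not_mem hj him)]

theorem exists_polynomial_of_coeff_eq_zero {u : (Fin n → Bool) → ℝ} {k : ℕ}
    (hu : ∀ S : Finset (Fin n), k < S.card → coeff u S = 0) :
    ∃ p : MvPolynomial (Fin n) ℝ, p.totalDegree ≤ k ∧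
      ∀ x, MvPolynomial.eval (toReal x) p = u x := by
  refine ⟨∑ S, MvPolynomial.C (coeff u S) *
    ∏ i ∈ S, (1 - MvPolynomial.C 2 * MvPolynomial.X i), ?_, fun x => ?_⟩
  · refine MvPolynomial.totalDegree_finsetSum_le fun S _ => ?_
    by_cases hS : k < S.card
    · simp [hu S hS]
    refine (MvPolynomial.totalDegree_mul _ _).trans ?_
    rw [MvPolynomial.totalDegree_C, zero_add]
    refine (MvPolynomial.totalDegree_finsetProd _ _).trans (le_trans ?_ (not_lt.mp hS))
    rw [Finset.card_eq_sum_ones]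
    refine Finset.sum_le_sum fun i _ => ?_
    refine (MvPolynomial.totalDegree_sub _ _).trans (max_le (by simp) ?_)
    exact (MvPolynomial.totalDegree_mul _ _).trans (by simp)
  · conv_rhs => rw [← synth_coeff u]
    simp only [map_sum, map_mul, map_prod, map_sub, map_one, MvPolynomial.eval_C,
      MvPolynomial.eval_X, synth, walsh]
    refine Finset.sum_congr rfl fun S _ => congrArg _ (Finset.prod_congr rfl fun i _ => ?_)
    cases h : x i <;> norm_num [toReal, boolSign, h]

/-- The Walsh coefficient of a Boolean function at a set of more than `100 d²` elements vanishes if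
the function is approximated to error `1/3` by a polynomial of degree `d`. -/
theorem card_le_of_coeff_ne_zero {f : (Fin n → Bool) → Bool} {p : MvPolynomial (Fin n) ℝ}
    (hp : ∀ x, |MvPolynomial.eval (toReal x) p - (if f x then 1 else 0)| ≤ 1 / 3)
    {S : Finset (Fin n)} (hf : ∑ x, boolSign (f x) * walsh S x ≠ 0) :
    S.card ≤ 100 * p.totalDegree ^ 2 := by
  obtain ⟨w, hw0, hwpos, hw⟩ := exists_weight_of_coeff_ne_zero hf
  let q : (Fin n → Bool) → ℝ := fun x => MvPolynomial.eval (toReal x) (p - MvPolynomial.C (1 / 2))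
  have hqp : ∀ x, q x = MvPolynomial.eval (toReal x) p - 1 / 2 := fun x => by simp [q]
  have hM : ∀ x, |q x| ≤ 5 / 6 := by
    intro x
    have h := abs_le.mp (hp x)
    rw [hqp, abs_le]
    split_ifs at h <;> constructor <;> linarith
  have hdeg : (p - MvPolynomial.C (1 / 2)).totalDegree ≤ p.totalDegree :=
    MvPolynomial.totalDegree_sub_C_le _ _
  have hq : ∀ U : Finset (Fin n), p.totalDegree < U.card → ∑ x, q x * walsh U x = 0 :=
    fun U hU => sum_eval_mul_walsh_eq_zero _ (hdeg.trans_lt hU)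
  let u : (Fin n → Bool) → ℝ := fun x => if f x then 0 else w x
  let v : (Fin n → Bool) → ℝ := fun x => if f x then w x else 0
  have huv : (∑ x, u x ^ 2) + ∑ x, v x ^ 2 = ∑ x, w x ^ 2 := by
    rw [← Finset.sum_add_distrib]
    exact Finset.sum_congr rfl fun x _ => by cases h : f x <;> simp [u, v, h]
  have hcomm := sum_commutator_le hM hq u v
  have hlow : 1 / 3 * ∑ x, ∑ i, u x * v (flip i x) ≤
      ∑ x, ∑ i, u x * v (flip i x) * (q (flip i x) - q x) := by
    simp only [Finset.mul_sum]
    refine Finset.sum_le_sum fun x _ => Finset.sum_le_sum fun i _ => ?_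
    have h1 := abs_le.mp (hp x)
    have h2 := abs_le.mp (hp (flip i x))
    have h3 := mul_nonneg (hw0 x) (hw0 (flip i x))
    rw [hqp, hqp]
    cases hx : f x <;> cases hy : f (flip i x) <;>
      simp [u, v, hx, hy] at h1 h2 ⊢
    rw [mul_comm]
    exact mul_le_mul_of_nonneg_left (by linarith) h3
  have hsens : ∑ x, ∑ i, (if f x ≠ f (flip i x) then w x * w (flip i x) else 0) =
      2 * ∑ x, ∑ i, u x * v (flip i x) := by
    have hsymm : ∑ x, ∑ i, u x * v (flip i x) = ∑ x, ∑ i, v x * u (flip i x) := by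
      rw [Finset.sum_comm, Finset.sum_comm (f := fun x i => v x * u (flip i x))]
      refine Finset.sum_congr rfl fun i _ => ?_
      rw [← sum_flip i]
      exact Finset.sum_congr rfl fun x _ => by rw [flip_flip, mul_comm]
    rw [two_mul]
    nth_rewrite 2 [hsymm]
    simp only [← Finset.sum_add_distrib]
    refine Finset.sum_congr rfl fun x _ => Finset.sum_congr rfl fun i _ => ?_
    cases hx : f x <;> cases hy : f (flip i x) <;> simp [u, v, hx, hy]
  rw [huv] at hcomm
  have hsqrt : √(S.card : ℝ) ≤ 10 * p.totalDegree := by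
    refine le_of_mul_le_mul_right ?_ hwpos
    linarith
  have hfin : (S.card : ℝ) ≤ 100 * (p.totalDegree : ℝ) ^ 2 := by
    have := (Real.sqrt_le_left (by positivity)).mp hsqrt
    linarith
  exact_mod_cast hfin

end BoolCube

/-- There is a universal constant `C > 0` such that for every `n ≥ 1` and
every total Boolean function `f : {0,1}^n → {0,1}`, `deg(f) ≤ C · adeg(f)²`. -/
theorem degB_le_adegB_sq : ∃ C : ℝ, 0 < C ∧
    ∀ n : ℕ, 1 ≤ n → ∀ f : (Fin n → Bool) → Bool,
      (degB f : ℝ) ≤ C * (adegB f : ℝ) ^ 2 := by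
  refine ⟨100, by norm_num, fun n _ f => ?_⟩
  have hne : {d | ∃ p : MvPolynomial (Fin n) ℝ, p.totalDegree = d ∧ ∀ x : Fin n → Bool,
      |MvPolynomial.eval (fun i => if x i then (1 : ℝ) else 0) p - (if f x then 1 else 0)| ≤
        1/3}.Nonempty := by
    obtain ⟨p, -, hp⟩ := BoolCube.exists_polynomial_of_coeff_eq_zero
      (u := fun x => if f x then 1 else 0) (k := n)
      fun S hS => absurd hS (by simpa using S.card_le_univ)
    exact ⟨_, p, rfl, fun x => by rw [hp x]; norm_num⟩
  obtain ⟨p, hpd, hp⟩ := Nat.sInf_mem hne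
  obtain ⟨r, hrd, hr⟩ := BoolCube.exists_polynomial_of_coeff_eq_zero
    (u := fun x => if f x then 1 else 0) (k := 100 * p.totalDegree ^ 2) (by
      intro S hS
      have hzero : ∑ x, BoolCube.boolSign (f x) * BoolCube.walsh S x = 0 := by
        by_contra h
        exact absurd (BoolCube.card_le_of_coeff_ne_zero hp h) (not_le.mpr hS)
      have hsum := BoolCube.sum_walsh_eq_zero (Finset.card_pos.mp (Nat.zero_lt_of_lt hS))
      have hexp : ∀ x, (if f x then (1 : ℝ) else 0) * BoolCube.walsh S x =
          (BoolCube.walsh S x - BoolCube.boolSign (f x) * BoolCube.walsh S x) / 2 := by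
        intro x
        cases h : f x <;> simp [BoolCube.boolSign]
      rw [BoolCube.coeff, Finset.sum_congr rfl fun x _ => hexp x, ← Finset.sum_div,
        Finset.sum_sub_distrib, hzero, hsum]
      simp)
  have hdeg : degB f ≤ 100 * adegB f ^ 2 := by
    have h1 : degB f ≤ r.totalDegree := Nat.sInf_le ⟨r, rfl, hr⟩
    have h2 : p.totalDegree = adegB f := hpd
    rw [← h2]
    exact h1.trans hrd
  exact_mod_cast hdeg
end

section
/- For every n ≥ 1 and every total Boolean function f : {0,1}^n → {0,1}, λ(f) ≤ deg(f). -/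
open Finset

/-- The Boolean vector obtained from `x` by negating the coordinate `i`. -/
def flipAt {ι : Type*} [DecidableEq ι] (i : ι) (x : ι → Bool) : ι → Bool :=
  Function.update x i (!x i)

/-- The Walsh character `x ↦ ∏ i ∈ S, (-1) ^ x i`. -/
def walsh {ι : Type*} (S : Finset ι) (x : ι → Bool) : ℝ :=
  ∏ i ∈ S, if x i then -1 else 1

/-- The unnormalized Walsh–Fourier coefficient of `v` at `S`. -/
def walshCoeff {ι : Type*} [Fintype ι] [DecidableEq ι] (v : (ι → Bool) → ℝ) (S : Finset ι) : ℝ :=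
  ∑ x, v x * walsh S x

/-- The Fourier weight of `v` on the levels above `k`. -/
def walshTail {ι : Type*} [Fintype ι] [DecidableEq ι] (v : (ι → Bool) → ℝ) (k : ℕ) : ℝ :=
  ∑ S with k < #S, walshCoeff v S ^ 2

theorem sum_walsh_mul_walsh {ι : Type*} [Fintype ι] (x y : ι → Bool) :
    ∑ S, walsh S x * walsh S y = if x = y then (2 : ℝ) ^ Fintype.card ι else 0 := by
  have h : ∀ S : Finset ι, walsh S x * walsh S y =
      ∏ i ∈ S, (if x i then (-1 : ℝ) else 1) * (if y i then -1 else 1) :=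
    fun S => prod_mul_distrib.symm
  simp only [h]
  rw [← powerset_univ, ← prod_one_add]
  split_ifs with hxy
  · subst hxy
    rw [prod_congr rfl (g := fun _ => (2 : ℝ))]
    · simp
    · intro i _
      cases x i <;> norm_num
  · obtain ⟨i, hi⟩ := Function.ne_iff.1 hxy
    refine prod_eq_zero (mem_univ i) ?_
    revert hi
    cases x i <;> cases y i <;> simp

section Walsh

variable {ι : Type*} [DecidableEq ι]

theorem flipAt_involutive (i : ι) : Function.Involutive (flipAt i) := by
  intro x
  simp [flipAt]

theorem flipAt_injective (x : ι → Bool) : Function.Injective fun i => flipAt i x := by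
  intro i j h
  by_contra hij
  have := congrFun h i
  simp [flipAt, Function.update_of_ne hij] at this

theorem walsh_flipAt (S : Finset ι) (i : ι) (x : ι → Bool) :
    walsh S (flipAt i x) = if i ∈ S then -walsh S x else walsh S x := by
  have off : ∀ T : Finset ι, i ∉ T → walsh T (flipAt i x) = walsh T x := by
    intro T hT
    refine prod_congr rfl fun j hj => ?_
    rw [flipAt, Function.update_of_ne (ne_of_mem_of_not_mem hj hT)]
  split_ifs with h
  · have key : ∀ y : ι → Bool, walsh S y = (if y i then -1 else 1) * walsh (S.erase i) y :=
      fun y => (mul_prod_erase S (fun j => if y j then (-1 : ℝ) else 1) h).symm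
    rw [key, key x, off _ (notMem_erase i S)]
    cases hx : x i <;> simp [flipAt, hx]
  · exact off S h

variable [Fintype ι]

theorem sum_comp_flipAt (i : ι) (h : (ι → Bool) → ℝ) : ∑ x, h (flipAt i x) = ∑ x, h x :=
  Equiv.sum_comp (flipAt_involutive i).toPerm h

theorem walsh_mul_walsh (R S : Finset ι) (x : ι → Bool) :
    walsh R x * walsh S x = walsh (symmDiff R S) x := by
  have key : ∀ T : Finset ι, walsh T x = ∏ i, if i ∈ T then (if x i then (-1 : ℝ) else 1) else 1 :=
    fun T => by simp [walsh, prod_ite_mem]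
  rw [key, key, key, ← prod_mul_distrib]
  refine prod_congr rfl fun i _ => ?_
  by_cases hR : i ∈ R <;> by_cases hS : i ∈ S <;> cases x i <;> simp [hR, hS, mem_symmDiff]

theorem walshCoeff_comp_flipAt (v : (ι → Bool) → ℝ) (i : ι) (S : Finset ι) :
    walshCoeff (fun x => v (flipAt i x)) S =
      if i ∈ S then -walshCoeff v S else walshCoeff v S := by
  rw [walshCoeff, ← sum_comp_flipAt i]
  simp only [walsh_flipAt, flipAt_involutive i _]
  split_ifs <;> simp [walshCoeff]

theorem walshCoeff_add (v w : (ι → Bool) → ℝ) (S : Finset ι) :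
    walshCoeff (fun x => v x + w x) S = walshCoeff v S + walshCoeff w S := by
  simp [walshCoeff, add_mul, sum_add_distrib]

theorem walshCoeff_sub (v w : (ι → Bool) → ℝ) (S : Finset ι) :
    walshCoeff (fun x => v x - w x) S = walshCoeff v S - walshCoeff w S := by
  simp [walshCoeff, sub_mul, sum_sub_distrib]

theorem walshCoeff_const_mul (c : ℝ) (v : (ι → Bool) → ℝ) (S : Finset ι) :
    walshCoeff (fun x => c * v x) S = c * walshCoeff v S := by
  simp [walshCoeff, mul_sum, mul_assoc]

theorem walshCoeff_sum {κ : Type*} (s : Finset κ) (v : κ → (ι → Bool) → ℝ) (S : Finset ι) :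
    walshCoeff (fun x => ∑ r ∈ s, v r x) S = ∑ r ∈ s, walshCoeff (v r) S := by
  simp only [walshCoeff, sum_mul]
  exact sum_comm

theorem walshCoeff_mul_walsh (v : (ι → Bool) → ℝ) (R S : Finset ι) :
    walshCoeff (fun x => v x * walsh R x) S = walshCoeff v (symmDiff R S) := by
  simp only [walshCoeff, mul_assoc, walsh_mul_walsh]

theorem walshCoeff_eq_zero_of_comp_flipAt {v : (ι → Bool) → ℝ} {i : ι} {S : Finset ι} (hi : i ∈ S)
    (hv : ∀ x, v (flipAt i x) = v x) : walshCoeff v S = 0 := by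
  have := walshCoeff_comp_flipAt v i S
  simp only [hv, if_pos hi] at this
  change walshCoeff v S = _ at this
  linarith

theorem walshCoeff_walsh (R S : Finset ι) :
    walshCoeff (walsh R) S = if R = S then (2 : ℝ) ^ Fintype.card ι else 0 := by
  have h := walshCoeff_mul_walsh (fun _ => 1) R S
  simp only [one_mul] at h
  change walshCoeff (walsh R) S = _ at h
  rw [h]
  split_ifs with hRS
  · simp [hRS, walshCoeff, walsh]
  · obtain ⟨i, hi⟩ : (symmDiff R S).Nonempty := by
      rw [nonempty_iff_ne_empty]
      exact fun h => hRS (symmDiff_eq_bot.1 h)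
    exact walshCoeff_eq_zero_of_comp_flipAt hi fun _ => rfl

theorem sum_walshCoeff_mul_walsh (v : (ι → Bool) → ℝ) (x : ι → Bool) :
    ∑ S, walshCoeff v S * walsh S x = 2 ^ Fintype.card ι * v x := by
  simp only [walshCoeff, sum_mul]
  rw [sum_comm]
  simp only [mul_assoc, ← mul_sum, sum_walsh_mul_walsh]
  simp [mul_comm]

/-- Parseval's identity on the Boolean cube. -/
theorem sum_walshCoeff_sq (v : (ι → Bool) → ℝ) :
    ∑ S, walshCoeff v S ^ 2 = 2 ^ Fintype.card ι * ∑ x, v x ^ 2 := by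
  have h : ∀ S, walshCoeff v S ^ 2 = ∑ x, v x * (walshCoeff v S * walsh S x) := by
    intro S
    rw [sq]
    nth_rewrite 2 [walshCoeff]
    rw [mul_sum]
    exact sum_congr rfl fun x _ => by ring
  simp only [h]
  rw [sum_comm]
  simp only [← mul_sum, sum_walshCoeff_mul_walsh]
  rw [mul_sum]
  exact sum_congr rfl fun x _ => by ring

theorem walshTail_le (v : (ι → Bool) → ℝ) (k : ℕ) :
    walshTail v k ≤ 2 ^ Fintype.card ι * ∑ x, v x ^ 2 := by
  rw [← sum_walshCoeff_sq]
  exact sum_le_sum_of_subset_of_nonneg (filter_subset _ _) fun _ _ _ => sq_nonneg _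

theorem sum_range_walshTail (v : (ι → Bool) → ℝ) {m : ℕ} (hm : Fintype.card ι ≤ m) :
    ∑ k ∈ range m, walshTail v k = ∑ S : Finset ι, (#S : ℝ) * walshCoeff v S ^ 2 := by
  simp only [walshTail, sum_filter]
  rw [sum_comm]
  refine sum_congr rfl fun S _ => ?_
  rw [← sum_filter, sum_const, nsmul_eq_mul]
  have : {k ∈ range m | k < #S} = range #S := by
    ext k
    have := card_le_univ S
    simp
    omega
  rw [this, card_range]

/-- The Dirichlet energy of `v` in terms of its Walsh–Fourier coefficients. -/
theorem sum_sub_flipAt_sq (v : (ι → Bool) → ℝ) :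
    2 ^ Fintype.card ι * ∑ i, ∑ x, (v x - v (flipAt i x)) ^ 2 =
      4 * ∑ S : Finset ι, (#S : ℝ) * walshCoeff v S ^ 2 := by
  rw [mul_sum]
  simp only [← sum_walshCoeff_sq, walshCoeff_sub, walshCoeff_comp_flipAt]
  rw [sum_comm, mul_sum]
  refine sum_congr rfl fun S _ => ?_
  have : ∀ i, (walshCoeff v S - if i ∈ S then -walshCoeff v S else walshCoeff v S) ^ 2 =
      if i ∈ S then 4 * walshCoeff v S ^ 2 else 0 := by
    intro i
    split_ifs <;> ring
  simp only [this, sum_ite_mem, univ_inter, sum_const, nsmul_eq_mul]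
  ring

/-- A function whose Fourier support lies in the levels up to `d` and whose values have absolute
value one moves Fourier weight up by at most `d` levels. -/
theorem walshTail_mul_le {g : (ι → Bool) → ℝ} {d : ℕ} (hg : ∀ x, g x ^ 2 = 1)
    (hd : ∀ S, d < #S → walshCoeff g S = 0) (v : (ι → Bool) → ℝ) (k : ℕ) :
    walshTail (fun x => g x * v x) (d + k) ≤ walshTail v k := by
  have hN : (0 : ℝ) < 2 ^ Fintype.card ι := by positivity
  set N : ℝ := 2 ^ Fintype.card ι with hNdef
  let low : (ι → Bool) → ℝ := fun x => ∑ R with #R ≤ k, N⁻¹ * walshCoeff v R * walsh R x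
  let high : (ι → Bool) → ℝ := fun x => v x - low x
  have hlow : ∀ S, walshCoeff low S = if #S ≤ k then walshCoeff v S else 0 := by
    intro S
    simp only [low, walshCoeff_sum, walshCoeff_const_mul, walshCoeff_walsh, ← hNdef]
    simp only [mul_ite, mul_zero, sum_ite_eq', mem_filter, mem_univ, true_and]
    split_ifs
    · field_simp
    · rfl
  have hhigh : ∀ S, walshCoeff high S = if k < #S then walshCoeff v S else 0 := by
    intro S
    simp only [high, walshCoeff_sub, hlow]
    by_cases h : k < #S
    · simp [h, not_le.2 h]
    · simp [h, not_lt.1 h]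
  have hzero : ∀ S, d + k < #S → walshCoeff (fun x => g x * low x) S = 0 := by
    intro S hS
    have : (fun x => g x * low x) =
        fun x => ∑ R with #R ≤ k, N⁻¹ * walshCoeff v R * (g x * walsh R x) := by
      funext x
      simp only [low, mul_sum]
      exact sum_congr rfl fun R _ => by ring
    rw [this, walshCoeff_sum]
    refine sum_eq_zero fun R hR => ?_
    have hRk : #R ≤ k := (mem_filter.1 hR).2
    have hsub : S ⊆ R ∪ symmDiff R S := by
      intro i hi
      by_cases hiR : i ∈ R <;> simp [hi, hiR, mem_symmDiff]
    have := (card_le_card hsub).trans (card_union_le _ _)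
    rw [walshCoeff_const_mul, walshCoeff_mul_walsh, hd _ (by omega), mul_zero]
  calc walshTail (fun x => g x * v x) (d + k)
      = walshTail (fun x => g x * high x) (d + k) := by
        refine sum_congr rfl fun S hS => ?_
        have : (fun x => g x * v x) = fun x => g x * low x + g x * high x := by
          funext x
          simp only [high]
          ring
        rw [this, walshCoeff_add, hzero S (mem_filter.1 hS).2, zero_add]
    _ ≤ N * ∑ x, (g x * high x) ^ 2 := walshTail_le _ _
    _ = N * ∑ x, high x ^ 2 := by simp only [mul_pow, hg, one_mul]
    _ = walshTail v k := by
        rw [← sum_walshCoeff_sq, walshTail, sum_filter]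
        refine sum_congr rfl fun S _ => ?_
        rw [hhigh]
        split_ifs <;> simp

theorem sum_sub_flipAt_sq_mul_le {g : (ι → Bool) → ℝ} {d : ℕ} (hg : ∀ x, g x ^ 2 = 1)
    (hd : ∀ S, d < #S → walshCoeff g S = 0) (v : (ι → Bool) → ℝ) :
    ∑ i, ∑ x, (g x * v x - g (flipAt i x) * v (flipAt i x)) ^ 2 ≤
      ∑ i, ∑ x, (v x - v (flipAt i x)) ^ 2 + 4 * d * ∑ x, v x ^ 2 := by
  have hN : (0 : ℝ) < 2 ^ Fintype.card ι := by positivity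
  have hgv := sum_sub_flipAt_sq fun x => g x * v x
  have hv := sum_sub_flipAt_sq v
  rw [← sum_range_walshTail _ le_rfl] at hv
  rw [← sum_range_walshTail _ (Nat.le_add_left _ d), sum_range_add] at hgv
  have h₁ : ∑ k ∈ range d, walshTail (fun x => g x * v x) k ≤
      d * (2 ^ Fintype.card ι * ∑ x, v x ^ 2) := by
    have h : ∀ k ∈ range d, walshTail (fun x => g x * v x) k ≤
        2 ^ Fintype.card ι * ∑ x, v x ^ 2 := by
      intro k _
      simpa only [mul_pow, hg, one_mul] using walshTail_le (fun x => g x * v x) k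
    simpa using sum_le_card_nsmul _ _ _ h
  have h₂ := sum_le_sum fun k (_ : k ∈ range (Fintype.card ι)) => walshTail_mul_le hg hd v k
  refine le_of_mul_le_mul_left ?_ hN
  linarith

/-- A polynomial of total degree at most `d` has no Fourier weight above level `d`. -/
theorem walshCoeff_eval_eq_zero (p : MvPolynomial ι ℝ) {S : Finset ι} (hS : p.totalDegree < #S) :
    walshCoeff (fun x => MvPolynomial.eval (fun i => if x i then (1 : ℝ) else 0) p) S = 0 := by
  simp only [MvPolynomial.eval_eq, walshCoeff_sum, walshCoeff_const_mul]
  refine sum_eq_zero fun m hm => mul_eq_zero_of_right _ ?_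
  have hcard : #m.support ≤ p.totalDegree := by
    refine le_trans ?_ (MvPolynomial.le_totalDegree hm)
    rw [Finsupp.sum, card_eq_sum_ones]
    exact sum_le_sum fun i hi => Nat.one_le_iff_ne_zero.2 (Finsupp.mem_support_iff.1 hi)
  obtain ⟨i, hiS, him⟩ := exists_mem_notMem_of_card_lt_card (hcard.trans_lt hS)
  refine walshCoeff_eq_zero_of_comp_flipAt hiS fun x => prod_congr rfl fun j hj => ?_
  rw [flipAt, Function.update_of_ne (ne_of_mem_of_not_mem hj him)]

theorem hammingDist_eq_one_iff (x y : ι → Bool) : hammingDist x y = 1 ↔ ∃ i, flipAt i x = y := by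
  constructor
  · intro h
    obtain ⟨i, hi⟩ := card_eq_one.1 h
    have hne : ∀ j, x j ≠ y j ↔ j = i := by simpa [Finset.ext_iff] using hi
    refine ⟨i, funext fun j => ?_⟩
    by_cases hj : j = i
    · subst hj
      have := (hne j).2 rfl
      revert this
      cases hx : x j <;> cases hy : y j <;> simp [flipAt, hx]
    · rw [flipAt, Function.update_of_ne hj]
      by_contra h
      exact hj ((hne j).1 h)
  · rintro ⟨i, rfl⟩
    refine card_eq_one.2 ⟨i, ?_⟩
    ext j
    by_cases hj : j = i
    · subst hj
      rw [mem_filter_univ]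
      simp [flipAt]
    · rw [mem_filter_univ]
      simp [flipAt, hj]

theorem sensAdj_mulVec (f : (ι → Bool) → Bool) (v : (ι → Bool) → ℝ) (x : ι → Bool) :
    (sensAdj f).mulVec v x = ∑ i, if f x ≠ f (flipAt i x) then v (flipAt i x) else 0 := by
  have h : ({y | hammingDist x y = 1} : Finset (ι → Bool)) = univ.image fun i => flipAt i x := by
    ext y
    simp [hammingDist_eq_one_iff]
  have h' : (sensAdj f).mulVec v x =
      ∑ y, if hammingDist x y = 1 then (if f x ≠ f y then v y else 0) else 0 := by
    simp only [Matrix.mulVec, dotProduct, sensAdj, Matrix.of_apply]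
    refine sum_congr rfl fun y _ => ?_
    by_cases h₁ : hammingDist x y = 1 <;> by_cases h₂ : f x = f y <;> simp [h₁, h₂]
  rw [h', ← sum_filter, h, sum_image (flipAt_injective x).injOn]

theorem four_mul_dotProduct_sensAdj (f : (ι → Bool) → Bool) {g : (ι → Bool) → ℝ}
    (hg : ∀ x, g x = if f x then -1 else 1) (v : (ι → Bool) → ℝ) :
    4 * (v ⬝ᵥ (sensAdj f).mulVec v) =
      ∑ i, ∑ x, (g x * v x - g (flipAt i x) * v (flipAt i x)) ^ 2 -
        ∑ i, ∑ x, (v x - v (flipAt i x)) ^ 2 := by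
  simp only [dotProduct, sensAdj_mulVec, mul_sum]
  rw [sum_comm, ← sum_sub_distrib]
  refine sum_congr rfl fun i _ => ?_
  rw [← sum_sub_distrib]
  refine sum_congr rfl fun x _ => ?_
  rw [hg, hg]
  cases f x <;> cases f (flipAt i x) <;> simp <;> ring

theorem abs_dotProduct_sensAdj_le (f : (ι → Bool) → Bool) {p : MvPolynomial ι ℝ}
    (hp : ∀ x : ι → Bool,
      MvPolynomial.eval (fun i => if x i then (1 : ℝ) else 0) p = if f x then 1 else 0)
    (v : (ι → Bool) → ℝ) :
    |v ⬝ᵥ (sensAdj f).mulVec v| ≤ p.totalDegree * (v ⬝ᵥ v) := by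
  let g : (ι → Bool) → ℝ := fun x => if f x then -1 else 1
  have hg : ∀ x, g x ^ 2 = 1 := fun x => by by_cases h : f x <;> simp [g, h]
  have hgg : ∀ x, g x * (g x * v x) = v x := fun x => by rw [← mul_assoc, ← sq, hg, one_mul]
  have hd : ∀ S, p.totalDegree < #S → walshCoeff g S = 0 := by
    intro S hS
    have h : g = fun x => MvPolynomial.eval (fun i => if x i then (1 : ℝ) else 0) 1 -
        2 * MvPolynomial.eval (fun i => if x i then (1 : ℝ) else 0) p := by
      funext x
      rw [hp]
      by_cases h : f x <;> simp [g, h]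
      norm_num
    rw [h, walshCoeff_sub, walshCoeff_const_mul, walshCoeff_eval_eq_zero p hS,
      walshCoeff_eval_eq_zero 1 (by rw [MvPolynomial.totalDegree_one]; omega)]
    simp
  have hq := four_mul_dotProduct_sensAdj f (g := g) (fun _ => rfl) v
  have h₁ := sum_sub_flipAt_sq_mul_le hg hd v
  have h₂ := sum_sub_flipAt_sq_mul_le hg hd fun x => g x * v x
  simp only [hgg, mul_pow, hg, one_mul] at h₂
  have hv : v ⬝ᵥ v = ∑ x, v x ^ 2 := sum_congr rfl fun x _ => (sq _).symm
  rw [hv, abs_le]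
  constructor <;> linarith

theorem sensAdj_isSymm (f : (ι → Bool) → Bool) : (sensAdj f).IsSymm := by
  ext x y
  simp [sensAdj, hammingDist_comm x y, eq_comm (a := f x)]

end Walsh

/-- A numerical radius bound on a real symmetric matrix bounds its spectral norm. -/
theorem specNorm_le_of_abs_dotProduct_le {I : Type*} [Fintype I] [DecidableEq I]
    {A : Matrix I I ℝ} (hA : A.IsSymm) {c : ℝ} (hc : 0 ≤ c)
    (h : ∀ v, |v ⬝ᵥ A.mulVec v| ≤ c * (v ⬝ᵥ v)) : specNorm A ≤ c := by
  have hbil : ∀ u v : I → ℝ, 2 * (u ⬝ᵥ A.mulVec v) ≤ c * (u ⬝ᵥ u + v ⬝ᵥ v) := by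
    intro u v
    have hsymm : v ⬝ᵥ A.mulVec u = u ⬝ᵥ A.mulVec v := by
      rw [Matrix.dotProduct_mulVec, ← Matrix.mulVec_transpose, hA.eq, dotProduct_comm]
    have h₁ := (abs_le.1 (h (u + v))).2
    have h₂ := (abs_le.1 (h (u - v))).1
    simp only [Matrix.mulVec_add, Matrix.mulVec_sub, dotProduct_add, add_dotProduct,
      dotProduct_sub, sub_dotProduct, hsymm, dotProduct_comm v u] at h₁ h₂
    linarith
  refine ContinuousLinearMap.opNorm_le_bound _ hc fun v => ?_
  set w := Matrix.toEuclideanCLM (𝕜 := ℝ) A v with hw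
  have hnorm : ∀ u : EuclideanSpace ℝ I, u.ofLp ⬝ᵥ u.ofLp = ‖u‖ ^ 2 := by
    intro u
    rw [EuclideanSpace.real_norm_sq_eq]
    exact sum_congr rfl fun x _ => (sq _).symm
  have hwv : A.mulVec v.ofLp = w.ofLp := by
    rw [hw, Matrix.ofLp_toEuclideanCLM]
  have key := hbil (‖v‖ • w.ofLp) (‖w‖ • v.ofLp)
  simp only [Matrix.mulVec_smul, hwv, smul_dotProduct, dotProduct_smul, smul_eq_mul] at key
  rw [hnorm, hnorm] at key
  rcases (norm_nonneg w).eq_or_lt with h0 | hwpos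
  · rw [← h0]
    positivity
  rcases (norm_nonneg v).eq_or_lt with h0 | hvpos
  · have : v = 0 := norm_eq_zero.1 h0.symm
    simp [hw, this]
  have hpos : 0 < ‖v‖ * ‖w‖ ^ 2 := by positivity
  refine le_of_mul_le_mul_left ?_ hpos
  nlinarith

/-- Every Boolean function is represented by a polynomial attaining `degB`. -/
theorem exists_totalDegree_eq_degB {n : ℕ} (f : (Fin n → Bool) → Bool) :
    ∃ p : MvPolynomial (Fin n) ℝ, p.totalDegree = degB f ∧ ∀ x : Fin n → Bool,
      MvPolynomial.eval (fun i => if x i then (1 : ℝ) else 0) p = if f x then 1 else 0 := by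
  let q : MvPolynomial (Fin n) ℝ :=
    ∑ y with f y = true, ∏ i, if y i then MvPolynomial.X i else 1 - MvPolynomial.X i
  refine Nat.sInf_mem (s := {d | ∃ p : MvPolynomial (Fin n) ℝ, p.totalDegree = d ∧
      ∀ x : Fin n → Bool,
        MvPolynomial.eval (fun i => if x i then (1 : ℝ) else 0) p = if f x then 1 else 0})
    ⟨q.totalDegree, q, rfl, fun x => ?_⟩
  have h : ∀ y : Fin n → Bool, MvPolynomial.eval (fun i => if x i then (1 : ℝ) else 0)
      (∏ i, if y i then MvPolynomial.X i else 1 - MvPolynomial.X i) = if y = x then 1 else 0 := by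
    intro y
    rw [map_prod]
    split_ifs with hy
    · subst hy
      refine prod_eq_one fun i _ => ?_
      cases hi : y i <;> simp [hi]
    · obtain ⟨i, hi⟩ := Function.ne_iff.1 hy
      refine prod_eq_zero (mem_univ i) ?_
      revert hi
      cases hyi : y i <;> cases hxi : x i <;> simp [hxi]
  simp only [q, map_sum, h, sum_ite_eq', mem_filter, mem_univ, true_and]

/-- For every `n ≥ 1` and every total Boolean function
`f : {0,1}^n → {0,1}`, `λ(f) ≤ deg(f)`. -/
theorem specSens_le_degB (n : ℕ) (hn : 1 ≤ n) (f : (Fin n → Bool) → Bool) :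
    specSens f ≤ (degB f : ℝ) := by
  obtain ⟨p, hdeg, hp⟩ := exists_totalDegree_eq_degB f
  rw [← hdeg]
  exact specNorm_le_of_abs_dotProduct_le (sensAdj_isSymm f) (Nat.cast_nonneg _)
    (abs_dotProduct_sensAdj_le f hp)
end
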